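/- arXiv:1401.6828 — 6 statements merged into one kernel-verified Lean document; each statement's English description precedes it below -/
import Mathlib

section
/- Let Q : [0, T⁺) → M_N(ℂ) be the maximal solution of the matrix Riccati equation Q'(t) + Q(t)² + V''(x_c(t)) = 0 with initial condition Q(0) = i b I_N, where b > 0 and t ↦ V''(x_c(t)) is a continuous map into real symmetric N×N matrices. Then Q(t) is a symmetric matrix (Q(t)ᵀ = Q(t)) for every t ∈ [0, T⁺). -/
open MeasureTheory Matrix Real Set Filter
open scoped InnerProductSpace ENNReal Topology

noncomputable section

attribute [local instance] Matrix.normedAddCommGroup Matrix.normedSpace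

/-- `ℝ^N` as a Euclidean space. -/
abbrev EucSp (N : ℕ) := EuclideanSpace ℝ (Fin N)

/-- A potential `V : ℝ^N → ℝ` is subquadratic if it is `C^∞` and all its derivatives of
order `≥ 2` are (globally) bounded. -/
def Subquadratic {N : ℕ} (V : EucSp N → ℝ) : Prop :=
  ContDiff ℝ (⊤ : ℕ∞) V ∧ ∀ n : ℕ, 2 ≤ n → ∃ C : ℝ, ∀ x, ‖iteratedFDeriv ℝ n V x‖ ≤ C

/-- `E : ℝ → ℝ^N` is piecewise continuous: on each compact interval it has finitely many
discontinuities and is bounded. -/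
def PiecewiseContinuous {N : ℕ} (E : ℝ → EucSp N) : Prop :=
  ∀ a b : ℝ, ∃ s : Finset ℝ,
    (∀ t ∈ Set.Icc a b, t ∉ s → ContinuousAt E t) ∧ ∃ C : ℝ, ∀ t ∈ Set.Icc a b, ‖E t‖ ≤ C

/-- The Hessian matrix `V''(x)` of `V` at `x`. -/
def hessMat {N : ℕ} (V : EucSp N → ℝ) (x : EucSp N) : Matrix (Fin N) (Fin N) ℝ :=
  Matrix.of fun i j =>
    iteratedFDeriv ℝ 2 V x ![EuclideanSpace.single i 1, EuclideanSpace.single j 1]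

/-- The operator norm of a matrix, induced by the Euclidean norm. -/
def opNorm {N : ℕ} {𝕜 : Type} [RCLike 𝕜] (M : Matrix (Fin N) (Fin N) 𝕜) : ℝ :=
  ‖LinearMap.toContinuousLinearMap (Matrix.toEuclideanLin M)‖

/-- Real part of a complex matrix. -/
def RePart {N : ℕ} (M : Matrix (Fin N) (Fin N) ℂ) : Matrix (Fin N) (Fin N) ℝ :=
  M.map Complex.re

/-- Imaginary part of a complex matrix. -/
def ImPart {N : ℕ} (M : Matrix (Fin N) (Fin N) ℂ) : Matrix (Fin N) (Fin N) ℝ :=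
  M.map Complex.im

/-- The normalization constant `C_N = (∫_{ℝ^N} e^{-‖y‖²} dy)^{1/2}`. -/
def CN (N : ℕ) : ℝ := Real.sqrt (∫ y : EucSp N, Real.exp (-‖y‖ ^ 2))

/-- The constant `C_* = (1/(6 C_N)) (∫_{ℝ^N} ‖y‖⁶ e^{-‖y‖²} dy)^{1/2}`. -/
def Cstar (N : ℕ) : ℝ :=
  (1 / (6 * CN N)) * Real.sqrt (∫ y : EucSp N, ‖y‖ ^ 6 * Real.exp (-‖y‖ ^ 2))

/-- `(x_c, v)` is a (global, `C¹`) solution of the controlled Newton equation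
`x_c'' + ∇V(x_c) = E`, `x_c(0) = x₀`, `x_c'(0) = v₀`; the second-order ODE holds at every
point where `E` is continuous. -/
def IsNewtonSol {N : ℕ} (V : EucSp N → ℝ) (E : ℝ → EucSp N) (x₀ v₀ : EucSp N)
    (x_c v : ℝ → EucSp N) : Prop :=
  x_c 0 = x₀ ∧ v 0 = v₀ ∧ Continuous v ∧ (∀ t, HasDerivAt x_c (v t) t) ∧
    ∀ t, ContinuousAt E t → HasDerivAt v (E t - gradient V (x_c t)) t

/-- Right-hand side of the Riccati equation `Q' = -(Q² + V''(x_c t))`. -/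
def riccatiF {N : ℕ} (V : EucSp N → ℝ) (x_c : ℝ → EucSp N)
    (Q : ℝ → Matrix (Fin N) (Fin N) ℂ) (t : ℝ) : Matrix (Fin N) (Fin N) ℂ :=
  -(Q t ^ 2 + (hessMat V (x_c t)).map (fun a : ℝ => (a : ℂ)))

/-- The initial datum `i b I_N`. -/
def riccatiInit (N : ℕ) (b : ℝ) : Matrix (Fin N) (Fin N) ℂ :=
  ((b : ℂ) * Complex.I) • (1 : Matrix (Fin N) (Fin N) ℂ)

/-- The bilinear form `⟨M y, y⟩ = ∑ᵢⱼ Mᵢⱼ yⱼ yᵢ` on `ℂ^N`, for a real vector `y`. -/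
def qFormC {N : ℕ} (M : Matrix (Fin N) (Fin N) ℂ) (y : EucSp N) : ℂ :=
  ∑ i, ∑ j, M i j * (y j : ℂ) * (y i : ℂ)

/-- The quadratic form `⟨M y, y⟩ = ∑ᵢⱼ Mᵢⱼ yⱼ yᵢ` on `ℝ^N`. -/
def qFormR {N : ℕ} (M : Matrix (Fin N) (Fin N) ℝ) (y : EucSp N) : ℝ :=
  ∑ i, ∑ j, M i j * y j * y i

/-- The classical action
`S(t,x) = ∫₀ᵗ (½‖x_c'(s)‖² - V(x_c(s))) ds + ⟨x_c'(t), x - x_c(t)⟩`. -/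
def action {N : ℕ} (V : EucSp N → ℝ) (x_c v : ℝ → EucSp N) (t : ℝ) (x : EucSp N) : ℝ :=
  (∫ s in (0:ℝ)..t, ((1:ℝ)/2 * ‖v s‖ ^ 2 - V (x_c s))) + ⟪v t, x - x_c t⟫_ℝ

/-- The trajectory-coherent state `ψ̃(t,x)`. -/
def psiTilde {N : ℕ} (V : EucSp N → ℝ) (E : ℝ → EucSp N) (b : ℝ)
    (x_c v : ℝ → EucSp N) (Q : ℝ → Matrix (Fin N) (Fin N) ℂ) (t : ℝ) (x : EucSp N) : ℂ :=
  ((b ^ ((N : ℝ) / 4) / CN N : ℝ) : ℂ) *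
    Complex.exp (Complex.I * (((action V x_c v t x : ℝ) : ℂ)
        + (1/2 : ℂ) * qFormC (Q t) (x - x_c t))
      + ∫ s in (0:ℝ)..t, (Complex.I * ((⟪x_c s, E s⟫_ℝ : ℝ) : ℂ) - (Q s).trace / 2))

/-- The third-order Taylor remainder of `V` at `x_c(t)`:
`V(x) - V(x_c) - ⟨∇V(x_c), x - x_c⟩ - ½⟨V''(x_c)(x - x_c), x - x_c⟩`. -/
def taylorRem3 {N : ℕ} (V : EucSp N → ℝ) (x_c : ℝ → EucSp N) (t : ℝ) (x : EucSp N) : ℝ :=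
  V x - V (x_c t) - ⟪gradient V (x_c t), x - x_c t⟫_ℝ
    - (1/2) * qFormR (hessMat V (x_c t)) (x - x_c t)

/-- The source term `r(t,x)` (Taylor remainder of `V` at `x_c(t)` multiplied by `-ψ̃`). -/
def rRem {N : ℕ} (V : EucSp N → ℝ) (E : ℝ → EucSp N) (b : ℝ)
    (x_c v : ℝ → EucSp N) (Q : ℝ → Matrix (Fin N) (Fin N) ℂ) (t : ℝ) (x : EucSp N) : ℂ :=
  -((taylorRem3 V x_c t x : ℝ) : ℂ) * psiTilde V E b x_c v Q t x

/-- Membership in the class `𝒱` of unit-norm states whose modulus is a Gaussian with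
covariance parameter `q` between `√(b/2) I_N` and `√(3b/2) I_N`. -/
def InGaussClass (N : ℕ) (b : ℝ) (φ : EucSp N → ℂ) : Prop :=
  eLpNorm φ 2 volume = 1 ∧
    ∃ (q : Matrix (Fin N) (Fin N) ℝ) (α : EucSp N), q.PosSemidef ∧
      (q - Real.sqrt (b/2) • 1).PosSemidef ∧ (Real.sqrt (3*b/2) • 1 - q).PosSemidef ∧
      ∀ᵐ x : EucSp N, ‖φ x‖ ^ 2 =
        q.det / (CN N) ^ 2 * Real.exp (-∑ i, (q.mulVec (fun j => x j - α j) i) ^ 2)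

/-- The set `𝒱` inside `L²(ℝ^N, ℂ)`. -/
def GaussSet (N : ℕ) (b : ℝ) : Set (Lp ℂ 2 (volume : Measure (EucSp N))) :=
  {φ | InGaussClass N b ⇑φ}

end

attribute [local instance] Matrix.normedAddCommGroup Matrix.normedSpace

/-- Submultiplicativity, up to the factor `N`, of the entrywise sup norm. -/
lemma supnorm_mul_le {N : ℕ} (A B : Matrix (Fin N) (Fin N) ℂ) :
    ‖A * B‖ ≤ N * (‖A‖ * ‖B‖) := by
  rw [Matrix.norm_le_iff (by positivity)]
  intro i j
  rw [Matrix.mul_apply]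
  calc ‖∑ k, A i k * B k j‖ ≤ ∑ k, ‖A i k * B k j‖ := norm_sum_le _ _
    _ ≤ ∑ _k : Fin N, ‖A‖ * ‖B‖ := by
        refine Finset.sum_le_sum fun k _ => ?_
        rw [norm_mul]
        exact mul_le_mul (Matrix.norm_entry_le_entrywise_sup_norm A)
          (Matrix.norm_entry_le_entrywise_sup_norm B) (norm_nonneg _) (norm_nonneg _)
    _ = N * (‖A‖ * ‖B‖) := by simp

/-- The Hessian of a smooth function is symmetric. -/
lemma hessMat_transpose {N : ℕ} {V : EucSp N → ℝ} (hV : Subquadratic V) (x : EucSp N) :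
    (hessMat V x)ᵀ = hessMat V x := by
  have h : IsSymmSndFDerivAt ℝ V x :=
    hV.1.contDiffAt.isSymmSndFDerivAt (by
      rw [minSmoothness_of_isRCLikeNormedField]
      exact WithTop.coe_le_coe.2 (le_top : (2 : ℕ∞) ≤ ⊤))
  ext i j
  simp only [hessMat, Matrix.transpose_apply, Matrix.of_apply, iteratedFDeriv_two_apply]
  exact h _ _

/-- Transposition preserves derivatives. -/
lemma hasDerivWithinAt_transpose {N : ℕ} {Q : ℝ → Matrix (Fin N) (Fin N) ℂ}
    {Q' : Matrix (Fin N) (Fin N) ℂ} {s : Set ℝ} {t : ℝ} (h : HasDerivWithinAt Q Q' s t) :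
    HasDerivWithinAt (fun u => (Q u)ᵀ) Q'ᵀ s t :=
  (LinearMap.toContinuousLinearMap
    (Matrix.transposeLinearEquiv (Fin N) (Fin N) ℝ ℂ).toLinearMap).hasFDerivAt.comp_hasDerivWithinAt
      t h

/-- Any solution `Q` on `[0, T⁺)` of the matrix Riccati equation
`Q' + Q² + V''(x_c(t)) = 0`, `Q(0) = i b I_N`, takes values in symmetric matrices. -/
theorem statement1 {N : ℕ} (hN : 1 ≤ N) (V : EucSp N → ℝ) (hV : Subquadratic V)
    (x_c : ℝ → EucSp N) (hxc : Continuous x_c) (b : ℝ) (hb : 0 < b)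
    (Tplus : ℝ) (Q : ℝ → Matrix (Fin N) (Fin N) ℂ)
    (hQ0 : Q 0 = riccatiInit N b)
    (hQ : ∀ t ∈ Set.Ico 0 Tplus, HasDerivWithinAt Q (riccatiF V x_c Q t) (Set.Ici 0) t) :
    ∀ t ∈ Set.Ico 0 Tplus, (Q t)ᵀ = Q t := by
  intro t ht
  have hsub : ∀ s ∈ Set.Icc 0 t, s ∈ Set.Ico 0 Tplus :=
    fun s hs => ⟨hs.1, lt_of_le_of_lt hs.2 ht.2⟩
  have hcont : ContinuousOn Q (Set.Icc 0 t) := fun s hs =>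
    ((hQ s (hsub s hs)).continuousWithinAt).mono Set.Icc_subset_Ici_self
  obtain ⟨C, hC⟩ := isCompact_Icc.exists_bound_of_continuousOn hcont
  have hder : ∀ s ∈ Set.Ico 0 Tplus, HasDerivWithinAt (fun u => (Q u)ᵀ - Q u)
      ((riccatiF V x_c Q s)ᵀ - riccatiF V x_c Q s) (Set.Ici 0) s :=
    fun s hs => (hasDerivWithinAt_transpose (hQ s hs)).sub (hQ s hs)
  have key := eq_zero_of_abs_deriv_le_mul_abs_self_of_eq_zero_right
    (f := fun u => (Q u)ᵀ - Q u)
    (f' := fun s => (riccatiF V x_c Q s)ᵀ - riccatiF V x_c Q s) (K := 2 * N * C)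
    (a := 0) (b := t)
    (fun s hs => ((hder s (hsub s hs)).continuousWithinAt).mono Set.Icc_subset_Ici_self)
    (fun s hs => (hder s (hsub s ⟨hs.1, hs.2.le⟩)).mono (Set.Ici_subset_Ici.2 hs.1))
    (by simp [hQ0, riccatiInit])
    (by
      intro s hs
      have hCs := hC s ⟨hs.1, hs.2.le⟩
      have hH : ((hessMat V (x_c s)).map (fun a : ℝ => (a : ℂ)))ᵀ
          = (hessMat V (x_c s)).map (fun a : ℝ => (a : ℂ)) := by
        rw [← Matrix.transpose_map, hessMat_transpose hV]
      have e : (riccatiF V x_c Q s)ᵀ - riccatiF V x_c Q s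
          = -((Q s)ᵀ * ((Q s)ᵀ - Q s) + ((Q s)ᵀ - Q s) * Q s) := by
        simp only [riccatiF, Matrix.transpose_neg, Matrix.transpose_add, hH,
          Matrix.transpose_pow]
        noncomm_ring
      simp only [e, norm_neg]
      have h1 := supnorm_mul_le (Q s)ᵀ ((Q s)ᵀ - Q s)
      have h2 := supnorm_mul_le ((Q s)ᵀ - Q s) (Q s)
      rw [Matrix.norm_transpose] at h1
      have h3 : (N : ℝ) * (‖Q s‖ * ‖(Q s)ᵀ - Q s‖) ≤ N * (C * ‖(Q s)ᵀ - Q s‖) := by gcongr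
      refine (norm_add_le _ _).trans ?_
      linarith)
  exact sub_eq_zero.1 (key t ⟨ht.1, le_rfl⟩)
end

section
/- Let Q : [0, T⁺) → M_N(ℂ) be the maximal solution of Q'(t) + Q(t)² + V''(x_c(t)) = 0 with Q(0) = i b I_N, and write Q₁(t) := Re Q(t), Q₂(t) := Im Q(t). Then for every t ∈ [0, T⁺) one has the Gronwall bound ‖Q₂(t)‖ ≤ b · exp(2 ∫₀ᵗ ‖Q₁(s)‖ ds), where ‖·‖ is the operator norm on matrices induced by the Euclidean norm. -/
open MeasureTheory Matrix Real Set Filter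
open scoped InnerProductSpace ENNReal Topology

noncomputable section

attribute [local instance] Matrix.normedAddCommGroup Matrix.normedSpace

end

attribute [local instance] Matrix.normedAddCommGroup Matrix.normedSpace

/-- `Im` part as a real-linear continuous map to operators. -/
noncomputable def imOp (N : ℕ) : Matrix (Fin N) (Fin N) ℂ →L[ℝ] (EucSp N →L[ℝ] EucSp N) :=
  LinearMap.toContinuousLinearMap
    { toFun := fun M => LinearMap.toContinuousLinearMap (Matrix.toEuclideanLin (ImPart M))
      map_add' := by
        intro A B
        have : ImPart (A + B) = ImPart A + ImPart B := by ext i j; simp [ImPart]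
        rw [this, map_add, map_add]
      map_smul' := by
        intro c A
        have : ImPart (c • A) = c • ImPart A := by ext i j; simp [ImPart]
        rw [this, map_smul, map_smul]; rfl }

/-- `Re` part as a real-linear continuous map to operators. -/
noncomputable def reOp (N : ℕ) : Matrix (Fin N) (Fin N) ℂ →L[ℝ] (EucSp N →L[ℝ] EucSp N) :=
  LinearMap.toContinuousLinearMap
    { toFun := fun M => LinearMap.toContinuousLinearMap (Matrix.toEuclideanLin (RePart M))
      map_add' := by
        intro A B
        have : RePart (A + B) = RePart A + RePart B := by ext i j; simp [RePart]
        rw [this, map_add, map_add]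
      map_smul' := by
        intro c A
        have : RePart (c • A) = c • RePart A := by ext i j; simp [RePart]
        rw [this, map_smul, map_smul]; rfl }

theorem imOp_norm {N : ℕ} (M : Matrix (Fin N) (Fin N) ℂ) : ‖imOp N M‖ = opNorm (ImPart M) := rfl

theorem reOp_norm {N : ℕ} (M : Matrix (Fin N) (Fin N) ℂ) : ‖reOp N M‖ = opNorm (RePart M) := rfl

theorem toCLM_mul {N : ℕ} (A B : Matrix (Fin N) (Fin N) ℝ) :
    LinearMap.toContinuousLinearMap (Matrix.toEuclideanLin (A * B)) =
      (LinearMap.toContinuousLinearMap (Matrix.toEuclideanLin A)).comp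
        (LinearMap.toContinuousLinearMap (Matrix.toEuclideanLin B)) := by
  ext x i
  simp [Matrix.toLpLin_apply, Matrix.mulVec_mulVec]

theorem imOp_riccati {N : ℕ} (V : EucSp N → ℝ) (x_c : ℝ → EucSp N)
    (Q : ℝ → Matrix (Fin N) (Fin N) ℂ) (t : ℝ) :
    imOp N (riccatiF V x_c Q t) =
      -((reOp N (Q t)).comp (imOp N (Q t)) + (imOp N (Q t)).comp (reOp N (Q t))) := by
  have h : ImPart (riccatiF V x_c Q t) =
      -(RePart (Q t) * ImPart (Q t) + ImPart (Q t) * RePart (Q t)) := by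
    ext i j
    simp [ImPart, RePart, riccatiF, pow_two, Matrix.mul_apply, Finset.sum_add_distrib]
  change LinearMap.toContinuousLinearMap (Matrix.toEuclideanLin (ImPart (riccatiF V x_c Q t))) = _
  rw [h, map_neg, map_neg, map_add, map_add, toCLM_mul, toCLM_mul]
  rfl

theorem imOp_init (N : ℕ) (b : ℝ) (hb : 0 < b) : ‖imOp N (riccatiInit N b)‖ ≤ b := by
  have h : ImPart (riccatiInit N b) = b • (1 : Matrix (Fin N) (Fin N) ℝ) := by
    ext i j
    by_cases hij : i = j <;> simp [ImPart, riccatiInit, Matrix.one_apply, hij]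
  refine ContinuousLinearMap.opNorm_le_bound _ hb.le fun x => ?_
  have : imOp N (riccatiInit N b) x = b • x := by
    change Matrix.toEuclideanLin (ImPart (riccatiInit N b)) x = _
    rw [h]
    ext i
    simp [Matrix.toLpLin_apply, Matrix.smul_mulVec]
  rw [this, norm_smul, Real.norm_eq_abs, abs_of_pos hb]

/-- Gronwall inequality with a variable continuous coefficient. -/
theorem gronwall_var {E : Type*} [NormedAddCommGroup E] [NormedSpace ℝ E] (f f' : ℝ → E)
    (g : ℝ → ℝ) (hg : Continuous g) (b T : ℝ) (hb : 0 < b)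
    (hT : 0 ≤ T) (hf0 : ‖f 0‖ ≤ b) (hfc : ContinuousOn f (Set.Icc 0 T))
    (hf : ∀ s ∈ Set.Ico 0 T, HasDerivWithinAt f (f' s) (Set.Ici s) s)
    (hbd : ∀ s ∈ Set.Ico 0 T, ‖f' s‖ ≤ g s * ‖f s‖) :
    ‖f T‖ ≤ b * Real.exp (∫ s in (0:ℝ)..T, g s) := by
  have key : ∀ ε : ℝ, 0 < ε → ‖f T‖ ≤ b * Real.exp ((∫ s in (0:ℝ)..T, g s) + ε * T) := by
    intro ε hε
    have hB : ∀ x, HasDerivAt (fun t => b * Real.exp ((∫ s in (0:ℝ)..t, g s) + ε * t))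
        (b * (Real.exp ((∫ s in (0:ℝ)..x, g s) + ε * x) * (g x + ε * 1))) x := by
      intro x
      exact ((((hg.integral_hasStrictDerivAt 0 x).hasDerivAt).add
        ((hasDerivAt_id x).const_mul ε)).exp).const_mul b
    refine image_norm_le_of_norm_deriv_right_lt_deriv_boundary hfc hf (by simpa using hf0) hB
      ?_ (Set.right_mem_Icc.2 hT)
    intro x hx hxe
    refine (hbd x hx).trans_lt ?_
    rw [hxe]
    have : 0 < b * Real.exp ((∫ s in (0:ℝ)..x, g s) + ε * x) := by positivity
    nlinarith
  have hlim : Filter.Tendsto (fun ε : ℝ => b * Real.exp ((∫ s in (0:ℝ)..T, g s) + ε * T))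
      (nhdsWithin 0 (Set.Ioi 0)) (nhds (b * Real.exp ((∫ s in (0:ℝ)..T, g s) + 0 * T))) := by
    apply Filter.Tendsto.mono_left _ nhdsWithin_le_nhds
    apply Continuous.tendsto
    fun_prop
  have := ge_of_tendsto hlim (Filter.eventually_of_mem self_mem_nhdsWithin key)
  simpa using this

/-- Gronwall bound for the imaginary part of the Riccati solution:
`‖Q₂(t)‖ ≤ b exp(2 ∫₀ᵗ ‖Q₁(s)‖ ds)`. -/
theorem statement2 {N : ℕ} (hN : 1 ≤ N) (V : EucSp N → ℝ) (hV : Subquadratic V)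
    (x_c : ℝ → EucSp N) (hxc : Continuous x_c) (b : ℝ) (hb : 0 < b)
    (Tplus : ℝ) (Q : ℝ → Matrix (Fin N) (Fin N) ℂ)
    (hQ0 : Q 0 = riccatiInit N b)
    (hQ : ∀ t ∈ Set.Ico 0 Tplus, HasDerivWithinAt Q (riccatiF V x_c Q t) (Set.Ici 0) t) :
    ∀ t ∈ Set.Ico 0 Tplus,
      opNorm (ImPart (Q t)) ≤
        b * Real.exp (2 * ∫ s in (0:ℝ)..t, opNorm (RePart (Q s))) := by
  intro t ht
  have hder : ∀ s ∈ Set.Ico 0 Tplus, HasDerivWithinAt (fun s => imOp N (Q s))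
      (imOp N (riccatiF V x_c Q s)) (Set.Ici 0) s := fun s hs =>
    (imOp N).hasFDerivAt.comp_hasDerivWithinAt s (hQ s hs)
  have hQc : ContinuousOn Q (Set.Icc 0 t) := fun s hs =>
    ((hQ s ⟨hs.1, hs.2.trans_lt ht.2⟩).continuousWithinAt).mono Set.Icc_subset_Ici_self
  set g : ℝ → ℝ := Set.IccExtend ht.1 (Set.domRestrict (Set.Icc 0 t)
    (fun s => 2 * ‖reOp N (Q s)‖)) with hgdef
  have hgc : Continuous g := by
    apply Continuous.Icc_extend'
    apply ContinuousOn.domRestrict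
    exact continuousOn_const.mul ((reOp N).continuous.comp_continuousOn hQc).norm
  have hge : ∀ s ∈ Set.Icc 0 t, g s = 2 * ‖reOp N (Q s)‖ := fun s hs => by
    rw [hgdef, Set.IccExtend_of_mem _ _ hs]; rfl
  have main := gronwall_var (fun s => imOp N (Q s)) (fun s => imOp N (riccatiF V x_c Q s)) g hgc
    b t hb ht.1 (by simpa only [hQ0] using imOp_init N b hb)
    ((imOp N).continuous.comp_continuousOn hQc)
    (fun s hs => (hder s ⟨hs.1, hs.2.trans ht.2⟩).mono (Set.Ici_subset_Ici.2 hs.1))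
    (fun s hs => by
      rw [hge s ⟨hs.1, hs.2.le⟩, imOp_riccati, norm_neg]
      refine (norm_add_le _ _).trans ?_
      have h1 := (reOp N (Q s)).opNorm_comp_le (imOp N (Q s))
      have h2 := (imOp N (Q s)).opNorm_comp_le (reOp N (Q s))
      linarith [mul_comm ‖imOp N (Q s)‖ ‖reOp N (Q s)‖])
  have hint : ∫ s in (0:ℝ)..t, g s = 2 * ∫ s in (0:ℝ)..t, opNorm (RePart (Q s)) := by
    rw [← intervalIntegral.integral_const_mul]
    apply intervalIntegral.integral_congr
    intro s hs
    rw [Set.uIcc_of_le ht.1] at hs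
    exact hge s hs
  rw [hint] at main
  exact main
end

section
/- Suppose T* > 0 satisfies t·(1 + b² e^{4t} + ‖V''‖∞) < 1 for all t ∈ (0, T*]. Then for every piecewise continuous E : ℝ → ℝ^N, the maximal solution Q : [0, T⁺) → M_N(ℂ) of Q' + Q² + V''(x_c(t)) = 0, Q(0) = i b I_N (with x_c the controlled Newton trajectory) is defined beyond T* (T⁺ > T*), and its real part satisfies ‖Re Q(t)‖ ≤ 1 for every t ∈ [0, T*], where ‖·‖ is the matrix operator norm. -/
open MeasureTheory Matrix Real Set Filter
open scoped InnerProductSpace ENNReal Topology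

noncomputable section

attribute [local instance] Matrix.normedAddCommGroup Matrix.normedSpace

end

attribute [local instance] Matrix.normedAddCommGroup Matrix.normedSpace


/-- Global solutions of a truncated ODE. -/
theorem exists_truncated_sol {F : Type*} [NormedAddCommGroup F] [NormedSpace ℝ F]
    [FiniteDimensional ℝ F] (G : F → F) (hG : ContDiff ℝ 1 G) (H : ℝ → F) (hH : Continuous H)
    (T : ℝ) (hT : 0 < T) (r : ℝ) (hr : 0 < r) (z0 : F) :
    ∃ (Z : ℝ → F) (χ : ℝ → ℝ), Z 0 = z0 ∧
      (∀ t ∈ Set.Icc 0 T, HasDerivWithinAt Z (χ t • (G (Z t) + H t)) (Set.Icc 0 T) t) ∧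
      (∀ t, 0 ≤ χ t ∧ χ t ≤ 1) ∧ (∀ t, ‖Z t‖ ≤ r → χ t = 1) := by
  have : CompleteSpace F := FiniteDimensional.complete ℝ F
  let φ : ContDiffBump (0 : F) := ⟨r, r + 1, hr, by linarith⟩
  have hφ1 : ContDiff ℝ 1 φ := φ.contDiff
  have hφG : ContDiff ℝ 1 (fun x => φ x • G x) := hφ1.smul hG
  have hφGs : HasCompactSupport (fun x => φ x • G x) := φ.hasCompactSupport.smul_right
  obtain ⟨K1, hK1⟩ := ContDiff.lipschitzWith_of_hasCompactSupport φ.hasCompactSupport hφ1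
    one_ne_zero
  obtain ⟨K2, hK2⟩ := ContDiff.lipschitzWith_of_hasCompactSupport hφGs hφG one_ne_zero
  obtain ⟨C1, hC1⟩ := hφGs.exists_bound_of_continuous hφG.continuous
  obtain ⟨C2, hC2⟩ := isCompact_Icc.exists_bound_of_continuousOn
    (hH.continuousOn (s := Set.Icc 0 T))
  have h0 : (0:ℝ) ∈ Set.Icc 0 T := ⟨le_rfl, hT.le⟩
  have hC1n : 0 ≤ C1 := (norm_nonneg _).trans (hC1 0)
  have hC2n : 0 ≤ C2 := (norm_nonneg _).trans (hC2 0 h0)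
  let f : ℝ → F → F := fun t x => φ x • (G x + H t)
  have hPL : IsPicardLindelof f (tmin := 0) (tmax := T) ⟨0, h0⟩ z0
      (Real.toNNReal ((C1 + C2) * T)) 0 (Real.toNNReal (C1 + C2))
      (K2 + K1 * Real.toNNReal C2) := by
    refine ⟨fun t ht => ?_, fun x _ => ?_, fun t ht x _ => ?_, ?_⟩
    · refine LipschitzWith.lipschitzOnWith ?_
      refine LipschitzWith.of_dist_le_mul fun x y => ?_
      have e : f t x - f t y = (φ x • G x - φ y • G y) + (φ x - φ y) • H t := by
        simp only [f, smul_add, sub_smul]; abel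
      rw [dist_eq_norm, e]
      refine (norm_add_le _ _).trans ?_
      rw [norm_smul]
      have a1 := hK2.dist_le_mul x y
      have a2 := hK1.dist_le_mul x y
      have a3 := hC2 t ht
      rw [dist_eq_norm] at a1 a2
      have a4 : ‖φ x - φ y‖ * ‖H t‖ ≤ (K1 * dist x y) * C2 :=
        mul_le_mul a2 a3 (norm_nonneg _) (by positivity)
      push_cast
      rw [Real.coe_toNNReal _ hC2n]
      nlinarith
    · exact (continuous_const.smul (continuous_const.add hH)).continuousOn
    · rw [Real.coe_toNNReal _ (by positivity)]
      have e : f t x = φ x • G x + φ x • H t := smul_add _ _ _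
      rw [e]
      refine (norm_add_le _ _).trans (add_le_add (hC1 x) ?_)
      rw [norm_smul, Real.norm_of_nonneg φ.nonneg]
      exact (mul_le_of_le_one_left (norm_nonneg _) φ.le_one).trans (hC2 t ht)
    · rw [Real.coe_toNNReal _ (by positivity), Real.coe_toNNReal _ (by positivity)]
      simp [hT.le]
  obtain ⟨Z, hZ0, hZ⟩ := hPL.exists_eq_forall_mem_Icc_hasDerivWithinAt₀
  refine ⟨Z, fun t => φ (Z t), hZ0, hZ, fun t => ⟨φ.nonneg, φ.le_one⟩, fun t ht => ?_⟩
  exact φ.one_of_mem_closedBall (by simpa [φ] using ht)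

/-- The a priori bound. -/
theorem apriori_bound {A : Type*} [NormedAddCommGroup A] [NormedSpace ℝ A]
    (X Y X' Y' : ℝ → A) (T b M : ℝ) (hb : 0 ≤ b) (hM : 0 ≤ M)
    (hT : T * (1 + b ^ 2 * Real.exp (4 * T) + M) < 1)
    (hX : ∀ t ∈ Set.Icc 0 T, HasDerivWithinAt X (X' t) (Set.Icc 0 T) t)
    (hY : ∀ t ∈ Set.Icc 0 T, HasDerivWithinAt Y (Y' t) (Set.Icc 0 T) t)
    (hX0 : X 0 = 0) (hY0 : ‖Y 0‖ ≤ b)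
    (hX' : ∀ t ∈ Set.Icc 0 T, ‖X' t‖ ≤ ‖X t‖ ^ 2 + ‖Y t‖ ^ 2 + M)
    (hY' : ∀ t ∈ Set.Icc 0 T, ‖Y' t‖ ≤ 2 * ‖X t‖ * ‖Y t‖) :
    ∀ t ∈ Set.Icc 0 T, ‖X t‖ ≤ 1 ∧ ‖Y t‖ ≤ b * Real.exp (2 * T) := by
  have hXc : ContinuousOn X (Set.Icc 0 T) := fun t ht => (hX t ht).continuousWithinAt
  have hYc : ContinuousOn Y (Set.Icc 0 T) := fun t ht => (hY t ht).continuousWithinAt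
  -- bounds up to time `s`
  have key : ∀ s ∈ Set.Icc 0 T, (∀ u ∈ Set.Ico 0 s, ‖X u‖ ≤ 1) →
      ‖X s‖ < 1 ∧ ‖Y s‖ ≤ b * Real.exp (2 * T) := by
    intro s hs hu
    have hsub : Set.Icc 0 s ⊆ Set.Icc 0 T := Set.Icc_subset_Icc_right hs.2
    have hmem : ∀ x ∈ Set.Ico 0 s, x ∈ Set.Icc 0 T := fun x hx => ⟨hx.1, hx.2.le.trans hs.2⟩
    have hnh : ∀ x ∈ Set.Ico 0 s, Set.Icc 0 T ∈ 𝓝[Set.Ici x] x := fun x hx =>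
      Icc_mem_nhdsGE_of_mem ⟨hx.1, hx.2.trans_le hs.2⟩
    have hYb : ∀ x ∈ Set.Icc 0 s, ‖Y x‖ ≤ b * Real.exp (2 * T) := by
      intro x hx
      have := norm_le_gronwallBound_of_norm_deriv_right_le (f := Y) (f' := Y') (δ := b) (K := 2)
        (ε := 0) (hYc.mono hsub)
        (fun x hx => (hY x (hmem x hx)).mono_of_mem_nhdsWithin (hnh x hx)) hY0
        (fun x hx => by
          have h1 := hY' x (hmem x hx)
          have h2 := hu x hx
          nlinarith [norm_nonneg (Y x)]) x hx
      rw [gronwallBound_ε0] at this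
      refine this.trans (mul_le_mul_of_nonneg_left (Real.exp_le_exp.2 ?_) hb)
      have := hx.2.trans hs.2
      linarith
    refine ⟨?_, hYb s ⟨hs.1, le_rfl⟩⟩
    have hXb := norm_image_sub_le_of_norm_deriv_right_le_segment (f := X) (f' := X')
      (C := 1 + b ^ 2 * Real.exp (4 * T) + M) (hXc.mono hsub)
      (fun x hx => (hX x (hmem x hx)).mono_of_mem_nhdsWithin (hnh x hx))
      (fun x hx => by
        have h1 := hX' x (hmem x hx)
        have h2 := hu x hx
        have h3 := hYb x ⟨hx.1, hx.2.le⟩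
        have h4 : ‖X x‖ ^ 2 ≤ 1 := pow_le_one₀ (norm_nonneg _) h2
        have h5 : ‖Y x‖ ^ 2 ≤ (b * Real.exp (2 * T)) ^ 2 :=
          pow_le_pow_left₀ (norm_nonneg _) h3 2
        have h6 : (b * Real.exp (2 * T)) ^ 2 = b ^ 2 * Real.exp (4 * T) := by
          rw [mul_pow, ← Real.exp_nat_mul]; congr 2; push_cast; ring
        linarith) s ⟨hs.1, le_rfl⟩
    rw [hX0, sub_zero, sub_zero] at hXb
    refine hXb.trans_lt (lt_of_le_of_lt ?_ hT)
    rw [mul_comm]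
    exact mul_le_mul_of_nonneg_right hs.2 (by positivity)
  have hall : ∀ t ∈ Set.Icc 0 T, ‖X t‖ < 1 := by
    by_contra! hcon
    obtain ⟨t0, ht0, ht0'⟩ := hcon
    let S : Set ℝ := Set.Icc 0 T ∩ (fun t => ‖X t‖) ⁻¹' Set.Ici 1
    have hSc : IsCompact S := isCompact_Icc.of_isClosed_subset
      (hXc.norm.preimage_isClosed_of_isClosed isClosed_Icc isClosed_Ici) Set.inter_subset_left
    obtain ⟨s, hsS, hsmin⟩ := hSc.exists_isLeast ⟨t0, ht0, ht0'⟩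
    have := (key s hsS.1 fun u hu => by
      by_contra! hlt
      have : s ≤ u := hsmin ⟨⟨hu.1, hu.2.le.trans hsS.1.2⟩, hlt.le⟩
      exact absurd hu.2 (not_lt.2 this)).1
    exact absurd hsS.2 (not_le.2 this)
  exact fun t ht => ⟨(hall t ht).le,
    (key t ht fun u hu => (hall u ⟨hu.1, hu.2.le.trans ht.2⟩).le).2⟩

/-- The continuous linear map attached to a real matrix. -/
noncomputable def mCLM {N : ℕ} : Matrix (Fin N) (Fin N) ℝ →ₐ[ℝ] (EucSp N →L[ℝ] EucSp N) :=
  (Matrix.toEuclideanCLM (n := Fin N) (𝕜 := ℝ)).toAlgEquiv.toAlgHom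

theorem opNorm_eq {N : ℕ} (A : Matrix (Fin N) (Fin N) ℝ) : opNorm A = ‖mCLM A‖ := rfl

theorem entry_le {N : ℕ} (A : Matrix (Fin N) (Fin N) ℝ) (i j : Fin N) : |A i j| ≤ ‖mCLM A‖ := by
  have h1 := (mCLM A).le_opNorm (EuclideanSpace.single j (1:ℝ))
  have h2 := PiLp.norm_apply_le (mCLM A (EuclideanSpace.single j (1:ℝ))) i
  have h3 : (mCLM A (EuclideanSpace.single j (1:ℝ))) i = A i j := by
    change (A *ᵥ (Pi.single j (1:ℝ))) i = A i j
    simp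
  rw [h3] at h2
  simp only [PiLp.norm_single, norm_one, mul_one] at h1
  exact h2.trans h1

/-- real part, as a continuous linear map -/
noncomputable def reL (N : ℕ) : Matrix (Fin N) (Fin N) ℂ →L[ℝ] (EucSp N →L[ℝ] EucSp N) :=
  LinearMap.toContinuousLinearMap
    (mCLM.toLinearMap ∘ₗ (Complex.reLm.mapMatrix : Matrix (Fin N) (Fin N) ℂ →ₗ[ℝ] _))

/-- imaginary part, as a continuous linear map -/
noncomputable def imL (N : ℕ) : Matrix (Fin N) (Fin N) ℂ →L[ℝ] (EucSp N →L[ℝ] EucSp N) :=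
  LinearMap.toContinuousLinearMap
    (mCLM.toLinearMap ∘ₗ (Complex.imLm.mapMatrix : Matrix (Fin N) (Fin N) ℂ →ₗ[ℝ] _))

theorem reL_eq {N : ℕ} (A : Matrix (Fin N) (Fin N) ℂ) : reL N A = mCLM (RePart A) := rfl
theorem imL_eq {N : ℕ} (A : Matrix (Fin N) (Fin N) ℂ) : imL N A = mCLM (ImPart A) := rfl

theorem rePart_sq {N : ℕ} (A : Matrix (Fin N) (Fin N) ℂ) :
    RePart (A ^ 2) = RePart A * RePart A - ImPart A * ImPart A := by
  ext i j
  simp [RePart, ImPart, pow_two, Matrix.mul_apply, Complex.mul_re, Finset.sum_sub_distrib]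

theorem imPart_sq {N : ℕ} (A : Matrix (Fin N) (Fin N) ℂ) :
    ImPart (A ^ 2) = RePart A * ImPart A + ImPart A * RePart A := by
  ext i j
  simp [RePart, ImPart, pow_two, Matrix.mul_apply, Complex.mul_im, Finset.sum_add_distrib]

theorem reL_field {N : ℕ} (A : Matrix (Fin N) (Fin N) ℂ) (H : Matrix (Fin N) (Fin N) ℝ) :
    reL N (-(A ^ 2 + H.map (fun a : ℝ => (a : ℂ)))) =
      -(reL N A * reL N A - imL N A * imL N A + mCLM H) := by
  rw [map_neg, map_add]
  simp only [reL_eq, imL_eq, rePart_sq, map_sub, map_mul]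
  congr 3

theorem imL_field {N : ℕ} (A : Matrix (Fin N) (Fin N) ℂ) (H : Matrix (Fin N) (Fin N) ℝ) :
    imL N (-(A ^ 2 + H.map (fun a : ℝ => (a : ℂ)))) =
      -(reL N A * imL N A + imL N A * reL N A) := by
  rw [map_neg, map_add]
  simp only [reL_eq, imL_eq, imPart_sq, map_add, map_mul]
  have : ImPart (H.map (fun a : ℝ => (a : ℂ))) = 0 := by
    ext i j; simp [ImPart]
  rw [this, map_zero, add_zero]

/-- bound for truncated Riccati solutions -/
theorem riccati_bound {N : ℕ} (Q : ℝ → Matrix (Fin N) (Fin N) ℂ) (χ : ℝ → ℝ)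
    (H : ℝ → Matrix (Fin N) (Fin N) ℝ) (T b M : ℝ) (hb : 0 ≤ b) (hM : 0 ≤ M)
    (hT : T * (1 + b ^ 2 * Real.exp (4 * T) + M) < 1)
    (hH : ∀ t, opNorm (H t) ≤ M)
    (hχ : ∀ t, 0 ≤ χ t ∧ χ t ≤ 1)
    (hQ0 : Q 0 = riccatiInit N b)
    (hQ : ∀ t ∈ Set.Icc 0 T, HasDerivWithinAt Q
      (χ t • -(Q t ^ 2 + (H t).map (fun a : ℝ => (a : ℂ)))) (Set.Icc 0 T) t) :
    ∀ t ∈ Set.Icc 0 T, opNorm (RePart (Q t)) ≤ 1 ∧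
      opNorm (ImPart (Q t)) ≤ b * Real.exp (2 * T) := by
  refine apriori_bound (fun t => reL N (Q t)) (fun t => imL N (Q t))
    (fun t => reL N (χ t • -(Q t ^ 2 + (H t).map (fun a : ℝ => (a : ℂ)))))
    (fun t => imL N (χ t • -(Q t ^ 2 + (H t).map (fun a : ℝ => (a : ℂ))))) T b M hb hM hT
    (fun t ht => (reL N).hasFDerivAt.comp_hasDerivWithinAt t (hQ t ht))
    (fun t ht => (imL N).hasFDerivAt.comp_hasDerivWithinAt t (hQ t ht)) ?_ ?_ ?_ ?_
  · have : RePart (riccatiInit N b) = 0 := by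
      ext i j
      by_cases h : i = j <;> simp [RePart, riccatiInit, h]
    simp only [hQ0, reL_eq, this, map_zero]
  · have : ImPart (riccatiInit N b) = b • 1 := by
      ext i j
      by_cases h : i = j <;> simp [ImPart, riccatiInit, h]
    simp only [hQ0, imL_eq, this, map_smul, map_one]
    rw [norm_smul, Real.norm_of_nonneg hb]
    exact mul_le_of_le_one_right hb ContinuousLinearMap.norm_id_le
  · intro t ht
    simp only [map_smul, reL_field]
    rw [norm_smul, Real.norm_of_nonneg (hχ t).1, norm_neg]
    refine (mul_le_of_le_one_left (norm_nonneg _) (hχ t).2).trans ?_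
    refine (norm_add_le _ _).trans (add_le_add ((norm_sub_le _ _).trans ?_) (hH t))
    rw [pow_two, pow_two]
    exact add_le_add (norm_mul_le _ _) (norm_mul_le _ _)
  · intro t ht
    simp only [map_smul, imL_field]
    rw [norm_smul, Real.norm_of_nonneg (hχ t).1, norm_neg]
    refine (mul_le_of_le_one_left (norm_nonneg _) (hχ t).2).trans ?_
    refine (norm_add_le _ _).trans ?_
    have h1 := norm_mul_le (reL N (Q t)) (imL N (Q t))
    have h2 := norm_mul_le (imL N (Q t)) (reL N (Q t))
    linarith

theorem hess_cont {N : ℕ} (V : EucSp N → ℝ) (hV : Subquadratic V) (x : ℝ → EucSp N)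
    (hx : Continuous x) :
    Continuous fun t => (hessMat V (x t)).map (fun a : ℝ => (a : ℂ)) := by
  have h : Continuous (iteratedFDeriv ℝ 2 V) :=
    hV.1.continuous_iteratedFDeriv (by
      have h2 : ((2 : ℕ) : ℕ∞) ≤ ⊤ := le_top
      exact WithTop.coe_le_coe.2 h2)
  refine continuous_matrix fun i j => ?_
  simp only [Matrix.map_apply, hessMat, Matrix.of_apply]
  refine Complex.continuous_ofReal.comp ?_
  exact (ContinuousMultilinearMap.apply ℝ (fun _ : Fin 2 => EucSp N) ℝ _).continuous.comp
    (h.comp hx)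

theorem sq_contDiff {N : ℕ} :
    ContDiff ℝ 1 (fun A : Matrix (Fin N) (Fin N) ℂ => -(A ^ 2)) := by
  refine ContDiff.neg ?_
  have e : ∀ i j, ContDiff ℝ 1 (fun A : Matrix (Fin N) (Fin N) ℂ => A i j) := fun i j =>
    (contDiff_pi.1 (contDiff_pi.1 (contDiff_id (𝕜 := ℝ) (E := Fin N → Fin N → ℂ)) i) j)
  refine contDiff_pi.2 fun i => contDiff_pi.2 fun j => ?_
  simp only [pow_two, Matrix.mul_apply]
  exact ContDiff.sum fun k _ => (e i k).mul (e k j)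

/-- If `T* > 0` satisfies `t (1 + b² e^{4t} + ‖V''‖∞) < 1` for all
`t ∈ (0, T*]`, then for every piecewise continuous `E` the maximal Riccati solution `Q` is
defined beyond `T*` and `‖Re Q(t)‖ ≤ 1` for all `t ∈ [0, T*]`. -/
theorem statement4 {N : ℕ} (hN : 1 ≤ N) (V : EucSp N → ℝ) (hV : Subquadratic V)
    (b M : ℝ) (hb : 0 < b) (hM : ∀ x, opNorm (hessMat V x) ≤ M)
    (Tstar : ℝ) (hTstar : 0 < Tstar)
    (hTs : ∀ t ∈ Set.Ioc 0 Tstar, t * (1 + b ^ 2 * Real.exp (4 * t) + M) < 1)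
    (E : ℝ → EucSp N) (hE : PiecewiseContinuous E)
    (x₀ v₀ : EucSp N) (x_c v : ℝ → EucSp N) (hxc : IsNewtonSol V E x₀ v₀ x_c v)
    (Q : ℝ → Matrix (Fin N) (Fin N) ℂ) (Tplus : EReal)
    (hQ0 : Q 0 = riccatiInit N b)
    (hQ : ∀ t : ℝ, 0 ≤ t → (t : EReal) < Tplus →
      HasDerivWithinAt Q (riccatiF V x_c Q t) (Set.Ici 0) t)
    (hmax : ∀ (T' : ℝ) (R : ℝ → Matrix (Fin N) (Fin N) ℂ), R 0 = riccatiInit N b →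
      (∀ t : ℝ, 0 ≤ t → t < T' →
        HasDerivWithinAt R (riccatiF V x_c R t) (Set.Ici 0) t) →
      (T' : EReal) ≤ Tplus) :
    (Tstar : EReal) < Tplus ∧
    ∀ t ∈ Set.Icc 0 Tstar, opNorm (RePart (Q t)) ≤ 1 := by
  have hM0 : 0 ≤ M := (norm_nonneg _).trans (hM 0)
  have hxcont : Continuous x_c :=
    continuous_iff_continuousAt.2 fun t => (hxc.2.2.2.1 t).continuousAt
  -- a slightly larger time
  obtain ⟨T, hTT, hT⟩ : ∃ T, Tstar < T ∧ T * (1 + b ^ 2 * Real.exp (4 * T) + M) < 1 := by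
    have hc : Continuous fun t : ℝ => t * (1 + b ^ 2 * Real.exp (4 * t) + M) := by fun_prop
    have h1 : ∀ᶠ t in 𝓝[>] Tstar, t * (1 + b ^ 2 * Real.exp (4 * t) + M) < 1 :=
      ((hc.tendsto Tstar).eventually_lt_const (hTs Tstar ⟨hTstar, le_rfl⟩)).filter_mono
        nhdsWithin_le_nhds
    obtain ⟨T, h2, h3⟩ := (h1.and self_mem_nhdsWithin).exists
    exact ⟨T, h3, h2⟩
  have hT0 : 0 < T := hTstar.trans hTT
  have hlt : (Tstar : EReal) < Tplus := by
    let r : ℝ := 1 + b * Real.exp (2 * T)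
    have hr : 0 < r := by positivity
    obtain ⟨R, χ, hR0, hR, hχ, hχ1⟩ := exists_truncated_sol
      (fun A : Matrix (Fin N) (Fin N) ℂ => -(A ^ 2)) sq_contDiff
      (fun t => -(hessMat V (x_c t)).map (fun a : ℝ => (a : ℂ))) (hess_cont V hV x_c hxcont).neg
      T hT0 r hr (riccatiInit N b)
    have hR' : ∀ t ∈ Set.Icc 0 T, HasDerivWithinAt R
        (χ t • -(R t ^ 2 + (hessMat V (x_c t)).map (fun a : ℝ => (a : ℂ)))) (Set.Icc 0 T) t := by
      intro t ht
      rw [neg_add]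
      exact hR t ht
    have hbd := riccati_bound R χ (fun t => hessMat V (x_c t)) T b M hb.le hM0 hT
      (fun t => hM _) hχ hR0 hR'
    have hone : ∀ t ∈ Set.Icc 0 T, χ t = 1 := by
      intro t ht
      refine hχ1 t ((Matrix.norm_le_iff hr.le).2 fun i j => ?_)
      refine (Complex.norm_le_abs_re_add_abs_im _).trans (add_le_add ?_ ?_)
      · exact (entry_le (RePart (R t)) i j).trans (hbd t ht).1
      · exact (entry_le (ImPart (R t)) i j).trans (hbd t ht).2
    refine lt_of_lt_of_le (EReal.coe_lt_coe_iff.2 hTT) (hmax T R hR0 fun t ht0 htT => ?_)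
    have h := hR' t ⟨ht0, htT.le⟩
    rw [hone t ⟨ht0, htT.le⟩, one_smul] at h
    refine h.mono_of_mem_nhdsWithin ?_
    filter_upwards [self_mem_nhdsWithin, nhdsWithin_le_nhds (Iio_mem_nhds htT)] with u hu1 hu2
    exact ⟨hu1, le_of_lt hu2⟩
  refine ⟨hlt, fun t ht => ?_⟩
  refine (riccati_bound Q (fun _ => 1) (fun t => hessMat V (x_c t)) Tstar b M hb.le hM0
    (hTs Tstar ⟨hTstar, le_rfl⟩) (fun t => hM _) (fun _ => ⟨zero_le_one, le_rfl⟩) hQ0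
    (fun s hs => ?_) t ht).1
  rw [one_smul]
  exact (hQ s hs.1 (lt_of_le_of_lt (EReal.coe_le_coe_iff.2 hs.2) hlt)).mono
    Set.Icc_subset_Ici_self
end

section
/- Let Q : [0, T⁺) → M_N(ℂ) be the maximal solution of Q' + Q² + V''(x_c(t)) = 0, Q(0) = i b I_N, and write Q₁ := Re Q, Q₂ := Im Q. Then for every t ∈ [0, T⁺) one has det Q₂(t) = b^N · exp(−2 ∫₀ᵗ Tr(Q₁(s)) ds); in particular Q₂(t) is invertible for all t ∈ [0, T⁺), and the function t ↦ det Q₂(t) satisfies the linear ODE (d/dt) det Q₂(t) = −2 Tr(Q₁(t)) · det Q₂(t). -/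
open MeasureTheory Matrix Real Set Filter
open scoped InnerProductSpace ENNReal Topology

noncomputable section

attribute [local instance] Matrix.normedAddCommGroup Matrix.normedSpace

end

attribute [local instance] Matrix.normedAddCommGroup Matrix.normedSpace

/-- Jacobi's formula for the derivative of a determinant. -/
theorem jacobi_aux {N : ℕ} (A : ℝ → Matrix (Fin N) (Fin N) ℝ) (A' : Matrix (Fin N) (Fin N) ℝ)
    (s : Set ℝ) (t : ℝ)
    (h : ∀ i j, HasDerivWithinAt (fun τ => A τ i j) (A' i j) s t) :
    HasDerivWithinAt (fun τ => (A τ).det) ((adjugate (A t) * A').trace) s t := by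
  have key : (adjugate (A t) * A').trace =
      ∑ σ : Equiv.Perm (Fin N), ((Equiv.Perm.sign σ : ℤ) : ℝ) *
        ∑ i, (∏ j ∈ Finset.univ.erase i, A t (σ j) j) • A' (σ i) i := by
    have h1 : ∀ i, (adjugate (A t) * A') i i = ((A t).updateCol i (fun k => A' k i)).det := by
      intro i
      rw [← cramer_apply, cramer_eq_adjugate_mulVec]
      rfl
    simp only [Matrix.trace, Matrix.diag_apply, h1, Matrix.det_apply']
    rw [Finset.sum_comm]
    refine Finset.sum_congr rfl fun σ _ => ?_
    rw [Finset.mul_sum]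
    refine Finset.sum_congr rfl fun i _ => ?_
    rw [← Finset.mul_prod_erase Finset.univ _ (Finset.mem_univ i)]
    have h2 : ∏ x ∈ Finset.univ.erase i, (A t).updateCol i (fun k => A' k i) (σ x) x
        = ∏ x ∈ Finset.univ.erase i, A t (σ x) x :=
      Finset.prod_congr rfl fun x hx => by
        rw [Matrix.updateCol_ne (Finset.ne_of_mem_erase hx)]
    rw [h2, Matrix.updateCol_self, smul_eq_mul]
    ring
  rw [key]
  simp only [Matrix.det_apply']
  refine HasDerivWithinAt.fun_sum fun σ _ => ?_
  refine HasDerivWithinAt.const_mul _ ?_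
  exact HasDerivWithinAt.fun_finsetProd fun i _ => h (σ i) i

/-- Uniqueness for the scalar linear equation `f' = -2 g f`. -/
theorem scalar_aux (f g : ℝ → ℝ) (t : ℝ) (ht : 0 ≤ t) (hg : ContinuousOn g (Set.Icc 0 t))
    (hf : ∀ s ∈ Set.Icc 0 t, HasDerivWithinAt f (-2 * g s * f s) (Set.Ici 0) s) :
    f t = f 0 * Real.exp (-2 * ∫ s in (0:ℝ)..t, g s) := by
  set G : ℝ → ℝ := Set.IccExtend ht ((Set.Icc 0 t).domRestrict g) with hG
  have hGc : Continuous G := (continuousOn_iff_continuous_domRestrict.1 hg).Icc_extend'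
  have hGg : ∀ s ∈ Set.Icc 0 t, G s = g s := fun s hs => by
    rw [hG, Set.IccExtend_of_mem ht _ hs]; rfl
  have hint : ∫ s in (0:ℝ)..t, g s = ∫ s in (0:ℝ)..t, G s := by
    refine intervalIntegral.integral_congr fun s hs => ?_
    rw [Set.uIcc_of_le ht] at hs
    exact (hGg s hs).symm
  have hI : ∀ s, HasDerivAt (fun u => ∫ x in (0:ℝ)..u, G x) (G s) s := fun s =>
    intervalIntegral.integral_hasDerivAt_right (hGc.intervalIntegrable _ _)
      hGc.aestronglyMeasurable.stronglyMeasurableAtFilter hGc.continuousAt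
  have hF : ∀ s ∈ Set.Icc 0 t, HasDerivWithinAt
      (fun u => f u * Real.exp (2 * ∫ x in (0:ℝ)..u, G x)) 0 (Set.Ici 0) s := by
    intro s hs
    have := (hf s hs).fun_mul (((hI s).const_mul 2).exp.hasDerivWithinAt (s := Set.Ici 0))
    rw [hGg s hs] at this
    refine this.congr_deriv ?_
    ring
  have hc := constant_of_has_deriv_right_zero
    (f := fun u => f u * Real.exp (2 * ∫ x in (0:ℝ)..u, G x)) (a := 0) (b := t)
    (fun s hs => (hF s hs).continuousWithinAt.mono Set.Icc_subset_Ici_self)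
    (fun s hs => (hF s ⟨hs.1, hs.2.le⟩).mono (Set.Ici_subset_Ici.2 hs.1)) t ⟨ht, le_rfl⟩
  simp only [intervalIntegral.integral_same, mul_zero, Real.exp_zero, mul_one] at hc
  rw [hint, ← hc, mul_assoc, ← Real.exp_add]
  simp

theorem im_riccati {N : ℕ} (V : EucSp N → ℝ) (x_c : ℝ → EucSp N)
    (Q : ℝ → Matrix (Fin N) (Fin N) ℂ) (t : ℝ) :
    ImPart (riccatiF V x_c Q t) =
      -(RePart (Q t) * ImPart (Q t) + ImPart (Q t) * RePart (Q t)) := by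
  ext i j
  simp only [ImPart, RePart, riccatiF, Matrix.map_apply, Matrix.neg_apply, Matrix.add_apply,
    pow_two, Matrix.mul_apply, Complex.neg_im, Complex.add_im, Complex.ofReal_im, add_zero,
    Complex.im_sum, Complex.mul_im, Finset.sum_add_distrib]


/-- The determinant of `Q₂(t) = Im Q(t)` satisfies
`det Q₂(t) = b^N exp(-2∫₀ᵗ Tr Q₁)`; in particular `Q₂(t)` is invertible, and
`t ↦ det Q₂(t)` satisfies the linear ODE `(det Q₂)' = -2 Tr(Q₁) det Q₂`. -/
theorem statement6 {N : ℕ} (hN : 1 ≤ N) (V : EucSp N → ℝ) (hV : Subquadratic V)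
    (x_c : ℝ → EucSp N) (hxc : Continuous x_c) (b : ℝ) (hb : 0 < b)
    (Tplus : ℝ) (Q : ℝ → Matrix (Fin N) (Fin N) ℂ)
    (hQ0 : Q 0 = riccatiInit N b)
    (hQ : ∀ t ∈ Set.Ico 0 Tplus, HasDerivWithinAt Q (riccatiF V x_c Q t) (Set.Ici 0) t) :
    ∀ t ∈ Set.Ico 0 Tplus,
      (ImPart (Q t)).det =
        b ^ N * Real.exp (-2 * ∫ s in (0:ℝ)..t, (RePart (Q s)).trace) ∧
      IsUnit (ImPart (Q t)) ∧
      HasDerivWithinAt (fun τ => (ImPart (Q τ)).det)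
        (-2 * (RePart (Q t)).trace * (ImPart (Q t)).det) (Set.Ici 0) t := by
  have hent : ∀ t ∈ Set.Ico 0 Tplus, ∀ i j,
      HasDerivWithinAt (fun τ => Q τ i j) (riccatiF V x_c Q t i j) (Set.Ici 0) t := by
    intro t ht i j
    exact hasDerivWithinAt_pi.1 (hasDerivWithinAt_pi.1 (hQ t ht) i) j
  have hdet : ∀ t ∈ Set.Ico 0 Tplus, HasDerivWithinAt (fun τ => (ImPart (Q τ)).det)
        (-2 * (RePart (Q t)).trace * (ImPart (Q t)).det) (Set.Ici 0) t := by
    intro t ht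
    have h := jacobi_aux (fun τ => ImPart (Q τ)) (ImPart (riccatiF V x_c Q t)) (Set.Ici 0) t
      (fun i j => Complex.imCLM.hasFDerivAt.comp_hasDerivWithinAt t (hent t ht i j))
    convert h using 1
    simp only [im_riccati]
    rw [mul_neg, mul_add, Matrix.trace_neg, Matrix.trace_add, ← mul_assoc, Matrix.trace_mul_comm,
      ← mul_assoc, ← mul_assoc, Matrix.mul_adjugate, Matrix.adjugate_mul]
    simp only [Matrix.smul_mul, Matrix.one_mul, Matrix.trace_smul, smul_eq_mul]
    ring
  have htr : ∀ t ∈ Set.Ico 0 Tplus,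
      ContinuousWithinAt (fun τ => (RePart (Q τ)).trace) (Set.Ici 0) t := by
    intro t ht
    simp only [Matrix.trace, Matrix.diag_apply, RePart, Matrix.map_apply]
    refine tendsto_finsetSum _ fun i _ => ?_
    exact Complex.continuous_re.continuousAt.comp_continuousWithinAt
      (hent t ht i i).continuousWithinAt
  have h0 : (ImPart (Q 0)).det = b ^ N := by
    have : ImPart (Q 0) = b • (1 : Matrix (Fin N) (Fin N) ℝ) := by
      ext i j
      by_cases hij : i = j <;> simp [ImPart, hQ0, riccatiInit, Matrix.one_apply, hij]
    rw [this, Matrix.det_smul]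
    simp
  intro t ht
  have hlt : ∀ s ∈ Set.Icc 0 t, s ∈ Set.Ico 0 Tplus := fun s hs => ⟨hs.1, hs.2.trans_lt ht.2⟩
  have hmain := scalar_aux (fun τ => (ImPart (Q τ)).det) (fun τ => (RePart (Q τ)).trace) t ht.1
    (fun s hs => (htr s (hlt s hs)).mono Set.Icc_subset_Ici_self) (fun s hs => hdet s (hlt s hs))
  simp only [h0] at hmain
  refine ⟨hmain, ?_, hdet t ht⟩
  rw [Matrix.isUnit_iff_isUnit_det, hmain]
  exact (mul_pos (pow_pos hb N) (Real.exp_pos _)).ne'.isUnit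
end

section
/- With x_c, Q and ψ̃ as in the definition of the trajectory-coherent state, the function ψ̃ satisfies, at every point (t,x) ∈ (0, T⁺) × ℝ^N such that E is continuous at t, the identity i ∂_t ψ̃(t,x) + ½ Δ_x ψ̃(t,x) − V(x) ψ̃(t,x) + ⟨E(t), x⟩ ψ̃(t,x) = r(t,x), where r(t,x) := −( V(x) − V(x_c(t)) − ⟨∇V(x_c(t)), x − x_c(t)⟩ − ½⟨V''(x_c(t))(x − x_c(t)), x − x_c(t)⟩ ) · ψ̃(t,x) is the cubic Taylor remainder of V at x_c(t) multiplied by ψ̃. -/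
open MeasureTheory Matrix Real Set Filter
open scoped InnerProductSpace ENNReal Topology

noncomputable section

attribute [local instance] Matrix.normedAddCommGroup Matrix.normedSpace

end

attribute [local instance] Matrix.normedAddCommGroup Matrix.normedSpace

theorem iter_two_line {N : ℕ} (f : EucSp N → ℂ) (hf : ContDiff ℝ 2 f) (x e : EucSp N) :
    iteratedFDeriv ℝ 2 f x ![e, e] = deriv (deriv (fun s : ℝ => f (x + s • e))) 0 := by
  have hd : Differentiable ℝ f := hf.differentiable (by norm_num)
  have hd1 : Differentiable ℝ (fderiv ℝ f) :=
    (hf.fderiv_right (m := 1) (by norm_num)).differentiable (by norm_num)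
  have hl : ∀ s : ℝ, HasDerivAt (fun s : ℝ => x + s • e) e s := by
    intro s
    simpa using ((hasDerivAt_id s).smul_const e).const_add x
  have h1 : deriv (fun s : ℝ => f (x + s • e)) = fun s => fderiv ℝ f (x + s • e) e := by
    funext s
    exact ((hd _).hasFDerivAt.comp_hasDerivAt s (hl s)).deriv
  rw [h1]
  have h2 : HasDerivAt (fun s : ℝ => fderiv ℝ f (x + s • e)) (fderiv ℝ (fderiv ℝ f) x e) 0 := by
    have h3 : HasFDerivAt (fderiv ℝ f) (fderiv ℝ (fderiv ℝ f) x) (x + (0:ℝ) • e) := by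
      simpa using (hd1 x).hasFDerivAt
    exact h3.comp_hasDerivAt 0 (hl 0)
  have h4 := h2.clm_apply (hasDerivAt_const (0:ℝ) e)
  rw [h4.deriv, iteratedFDeriv_two_apply]
  simp

theorem deriv2_exp_quad (c A B : ℂ) :
    deriv (deriv (fun s : ℝ => c * Complex.exp ((s:ℂ) * A + (s:ℂ)^2 * B))) 0
      = c * (A ^ 2 + 2 * B) := by
  have hp : ∀ s : ℝ, HasDerivAt (fun s : ℝ => (s:ℂ) * A + (s:ℂ)^2 * B) (A + 2 * s * B) s := by
    intro s
    have h0 : HasDerivAt (fun s : ℝ => (s:ℂ)) 1 s := Complex.ofRealCLM.hasDerivAt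
    exact ((h0.mul_const A).fun_add ((h0.fun_pow 2).mul_const B)).congr_deriv (by simp)
  have h1 : deriv (fun s : ℝ => c * Complex.exp ((s:ℂ) * A + (s:ℂ)^2 * B))
      = fun s : ℝ => c * (Complex.exp ((s:ℂ) * A + (s:ℂ)^2 * B) * (A + 2 * s * B)) := by
    funext s
    exact ((hp s).cexp.const_mul c).deriv
  rw [h1]
  have h0 : HasDerivAt (fun s : ℝ => (s:ℂ)) 1 0 := Complex.ofRealCLM.hasDerivAt
  have h2 : HasDerivAt (fun s : ℝ => A + 2 * (s:ℂ) * B) (2 * B) 0 := by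
    simpa using ((h0.const_mul 2).mul_const B).const_add A
  rw [(((hp 0).cexp.fun_mul h2).const_mul c).deriv]
  simp only [Complex.ofReal_zero, zero_mul, mul_zero, ne_eq, OfNat.ofNat_ne_zero,
    not_false_eq_true, zero_pow, add_zero, Complex.exp_zero]
  ring

/-- complexified vector -/
def cvec {N : ℕ} (y : EucSp N) : Fin N → ℂ := fun i => (y i : ℂ)

theorem qFormC_eq {N : ℕ} (M : Matrix (Fin N) (Fin N) ℂ) (y : EucSp N) :
    qFormC M y = cvec y ⬝ᵥ M *ᵥ cvec y := by
  simp only [qFormC, dotProduct, mulVec, cvec, Finset.mul_sum]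
  exact Finset.sum_congr rfl fun i _ => Finset.sum_congr rfl fun j _ => by ring

theorem sym_dot {N : ℕ} (M : Matrix (Fin N) (Fin N) ℂ) (hM : Mᵀ = M) (a c : Fin N → ℂ) :
    a ⬝ᵥ M *ᵥ c = c ⬝ᵥ M *ᵥ a := by
  rw [dotProduct_mulVec, ← mulVec_transpose, hM, dotProduct_comm]

theorem qFormC_line {N : ℕ} (M : Matrix (Fin N) (Fin N) ℂ) (hM : Mᵀ = M) (y : EucSp N)
    (i : Fin N) (s : ℝ) :
    qFormC M (y + s • EuclideanSpace.single i (1:ℝ)) =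
      qFormC M y + s * (2 * (M *ᵥ cvec y) i) + (s:ℂ)^2 * M i i := by
  have h : cvec (y + s • EuclideanSpace.single i (1:ℝ)) = cvec y + (s:ℂ) • Pi.single i 1 := by
    funext j
    by_cases hj : j = i
    · subst hj; simp [cvec]
    · simp [cvec, hj]
  rw [qFormC_eq, qFormC_eq, h]
  simp only [mulVec_add, add_dotProduct, dotProduct_add, mulVec_smul, smul_dotProduct,
    dotProduct_smul]
  rw [sym_dot M hM (cvec y) (Pi.single i 1)]
  simp only [single_dotProduct, mulVec_single_one, col_apply, one_mul, smul_eq_mul]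
  ring

theorem laplace {N : ℕ} (V : EucSp N → ℝ) (E : ℝ → EucSp N) (b : ℝ)
    (x_c v : ℝ → EucSp N) (Q : ℝ → Matrix (Fin N) (Fin N) ℂ) (t : ℝ) (x : EucSp N)
    (hM : (Q t)ᵀ = Q t) (i : Fin N) :
    iteratedFDeriv ℝ 2 (fun y => psiTilde V E b x_c v Q t y) x
            ![EuclideanSpace.single i 1, EuclideanSpace.single i 1]
    = psiTilde V E b x_c v Q t x *
      (- (cvec (v t) i + (Q t *ᵥ cvec (x - x_c t)) i) ^ 2 + Complex.I * Q t i i) := by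
  rw [iter_two_line]
  · have h : (fun s : ℝ => psiTilde V E b x_c v Q t (x + s • EuclideanSpace.single i (1:ℝ)))
      = fun s : ℝ => psiTilde V E b x_c v Q t x * Complex.exp ((s:ℂ) *
        (Complex.I * (cvec (v t) i + (Q t *ᵥ cvec (x - x_c t)) i))
          + (s:ℂ)^2 * (Complex.I / 2 * Q t i i)) := by
      funext s
      have hx : x + s • EuclideanSpace.single i (1:ℝ) - x_c t
        = (x - x_c t) + s • EuclideanSpace.single i (1:ℝ) := by abel
      simp only [psiTilde]
      rw [mul_assoc, ← Complex.exp_add]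
      congr 2
      simp only [action]
      rw [hx, qFormC_line _ hM, inner_add_right, inner_smul_right]
      have : ⟪v t, EuclideanSpace.single i (1:ℝ)⟫_ℝ = v t i := by
        simp [EuclideanSpace.inner_single_right]
      rw [this]
      simp only [cvec]
      push_cast
      ring
    rw [h, deriv2_exp_quad, mul_pow, Complex.I_sq]
    ring
  · have hq : ∀ j : Fin N, ContDiff ℝ 2 (fun y : EucSp N => (((y - x_c t) j : ℝ) : ℂ)) := by
      intro j
      refine Complex.ofRealCLM.contDiff.comp ?_
      exact (EuclideanSpace.proj (𝕜 := ℝ) j).contDiff.comp (contDiff_id.sub contDiff_const)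
    have ha : ContDiff ℝ 2 (fun y : EucSp N => ((action V x_c v t y : ℝ) : ℂ)) := by
      have ha' : ContDiff ℝ 2 (fun y : EucSp N => action V x_c v t y) := by
        unfold action
        exact contDiff_const.add (contDiff_const.inner ℝ (contDiff_id.sub contDiff_const))
      exact Complex.ofRealCLM.contDiff.comp ha'
    have hQ : ContDiff ℝ 2 (fun y : EucSp N => qFormC (Q t) (y - x_c t)) := by
      unfold qFormC
      refine ContDiff.sum fun i _ => ContDiff.sum fun j _ => ?_
      exact (contDiff_const.mul (hq j)).mul (hq i)
    unfold psiTilde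
    refine contDiff_const.mul (ContDiff.cexp ?_)
    exact (contDiff_const.mul (ha.add (contDiff_const.mul hQ))).add contDiff_const

theorem entry_deriv {N : ℕ} {Q : ℝ → Matrix (Fin N) (Fin N) ℂ} {Q' : Matrix (Fin N) (Fin N) ℂ}
    {t : ℝ} {s : Set ℝ} (h : HasDerivWithinAt Q Q' s t) (i j : Fin N) :
    HasDerivWithinAt (fun τ => Q τ i j) (Q' i j) s t := by
  have h1 := (hasDerivWithinAt_pi.1 h) i
  exact (hasDerivWithinAt_pi.1 h1) j

theorem hess_symm {N : ℕ} (V : EucSp N → ℝ) (hV : Subquadratic V) (x : EucSp N) :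
    (hessMat V x)ᵀ = hessMat V x := by
  ext i j
  simp only [hessMat, transpose_apply, of_apply, iteratedFDeriv_two_apply]
  have h : IsSymmSndFDerivAt ℝ V x := by
    apply (hV.1.contDiffAt).isSymmSndFDerivAt
    rw [minSmoothness_of_isRCLikeNormedField]
    exact WithTop.coe_le_coe.2 (le_top : (2 : ℕ∞) ≤ ⊤)
  exact h.eq _ _

theorem Q_symm {N : ℕ} (V : EucSp N → ℝ) (hV : Subquadratic V) (b : ℝ)
    (x_c : ℝ → EucSp N)
    (Tplus : ℝ) (Q : ℝ → Matrix (Fin N) (Fin N) ℂ)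
    (hQ0 : Q 0 = riccatiInit N b)
    (hQ : ∀ t ∈ Set.Ico 0 Tplus, HasDerivWithinAt Q (riccatiF V x_c Q t) (Set.Ici 0) t)
    (t : ℝ) (ht0 : 0 < t) (ht : t < Tplus) : (Q t)ᵀ = Q t := by
  have hcont : ContinuousOn Q (Icc 0 t) := by
    intro s hs
    exact ((hQ s ⟨hs.1, hs.2.trans_lt ht⟩).continuousWithinAt).mono Icc_subset_Ici_self
  obtain ⟨C, hC⟩ := isCompact_Icc.exists_bound_of_continuousOn hcont
  have hC0 : 0 ≤ C := (norm_nonneg _).trans (hC 0 ⟨le_rfl, ht0.le⟩)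
  have hmul : ∀ A B : Matrix (Fin N) (Fin N) ℂ, ‖A * B‖ ≤ N * (‖A‖ * ‖B‖) := by
    intro A B
    rw [Matrix.norm_le_iff (by positivity)]
    intro i j
    rw [mul_apply]
    refine (norm_sum_le _ _).trans ?_
    calc ∑ k, ‖A i k * B k j‖ ≤ ∑ k : Fin N, ‖A‖ * ‖B‖ := by
          refine Finset.sum_le_sum fun k _ => ?_
          rw [norm_mul]
          exact mul_le_mul (A.norm_entry_le_entrywise_sup_norm) (B.norm_entry_le_entrywise_sup_norm)
            (norm_nonneg _) (norm_nonneg _)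
      _ = _ := by simp
  let D : ℝ → Matrix (Fin N) (Fin N) ℂ := fun s => Q s - (Q s)ᵀ
  have hD : ∀ s ∈ Ico 0 t, HasDerivWithinAt D (-(Q s * D s + D s * (Q s)ᵀ)) (Ici s) s := by
    intro s hs
    have h := (hQ s ⟨hs.1, hs.2.trans ht⟩).mono (Ici_subset_Ici.2 hs.1)
    have h2 : HasDerivWithinAt D (riccatiF V x_c Q s - (riccatiF V x_c Q s)ᵀ) (Ici s) s := by
      refine h.sub ?_
      refine hasDerivWithinAt_pi.2 fun i => hasDerivWithinAt_pi.2 fun j => ?_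
      exact entry_deriv h j i
    convert h2 using 1
    have hm : ((hessMat V (x_c s)).map (fun a : ℝ => (a : ℂ)))ᵀ
        = (hessMat V (x_c s)).map (fun a : ℝ => (a : ℂ)) := by
      rw [← transpose_map, hess_symm V hV]
    simp only [riccatiF, transpose_neg, transpose_add, hm, transpose_pow, D]
    noncomm_ring
  have hDc : ContinuousOn D (Icc 0 t) := by
    refine hcont.sub ?_
    refine continuousOn_pi.2 fun i => continuousOn_pi.2 fun j => ?_
    exact continuousOn_pi.1 (continuousOn_pi.1 hcont j) i
  have hD0 : ‖D 0‖ ≤ 0 := by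
    simp [D, hQ0, riccatiInit]
  have hT : ∀ M : Matrix (Fin N) (Fin N) ℂ, ‖Mᵀ‖ = ‖M‖ := fun M => Matrix.norm_transpose M
  have hb := norm_le_gronwallBound_of_norm_deriv_right_le (δ := 0) (K := 2 * N * C) (ε := 0) hDc hD hD0
    (by
      intro s hs
      have hs' : s ∈ Icc 0 t := ⟨hs.1, hs.2.le⟩
      rw [norm_neg, add_zero]
      refine (norm_add_le _ _).trans ?_
      have h1 := hmul (Q s) (D s)
      have h2 := hmul (D s) (Q s)ᵀ
      rw [hT] at h2
      have h3 : ‖Q s‖ * ‖D s‖ ≤ C * ‖D s‖ := mul_le_mul_of_nonneg_right (hC s hs') (norm_nonneg _)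
      have h4 : (N:ℝ) * (‖Q s‖ * ‖D s‖) ≤ N * (C * ‖D s‖) :=
        mul_le_mul_of_nonneg_left h3 (by positivity)
      rw [mul_comm ‖D s‖] at h2
      linarith) t ⟨ht0.le, le_rfl⟩
  rw [gronwallBound_ε0_δ0] at hb
  have h0 : D t = 0 := norm_le_zero_iff.1 hb
  exact (sub_eq_zero.1 h0).symm

theorem E_int {N : ℕ} 
    (E : ℝ → EucSp N) (hE : PiecewiseContinuous E) 
    (x_c : ℝ → EucSp N) (hx : Continuous x_c) (Tplus : ℝ) (Q : ℝ → Matrix (Fin N) (Fin N) ℂ)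
    (hQ : ContinuousOn Q (Ico 0 Tplus)) (t : ℝ) (ht0 : 0 < t) (ht : t < Tplus)
    (hEt : ContinuousAt E t) :
    HasDerivAt (fun τ => ∫ s in (0:ℝ)..τ, (Complex.I * ((⟪x_c s, E s⟫_ℝ : ℝ) : ℂ) - (Q s).trace / 2))
      (Complex.I * ((⟪x_c t, E t⟫_ℝ : ℝ) : ℂ) - (Q t).trace / 2) t := by
  obtain ⟨T, hT1, hT2⟩ := exists_between ht
  obtain ⟨S, hS, C, hC⟩ := hE 0 T
  have hTr : ContinuousOn (fun s => (Q s).trace) (Ico 0 Tplus) := by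
    unfold Matrix.trace
    refine continuousOn_finsetSum _ fun i _ => ?_
    exact continuousOn_pi.1 (continuousOn_pi.1 hQ i) i
  have hTrat : ∀ s ∈ Ioo 0 T, ContinuousAt (fun s => (Q s).trace) s := fun s hs =>
    hTr.continuousAt (Ico_mem_nhds hs.1 (hs.2.trans hT2))
  have hIoo : ∀ s ∈ Ioo 0 T, ContinuousAt E s → ContinuousAt
      (fun s => (Complex.I * ((⟪x_c s, E s⟫_ℝ : ℝ) : ℂ) - (Q s).trace / 2)) s := by
    intro s hs hEs
    have h1 : ContinuousAt (fun s => ((⟪x_c s, E s⟫_ℝ : ℝ) : ℂ)) s :=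
      Complex.continuous_ofReal.continuousAt.comp (hx.continuousAt.inner hEs)
    exact (continuousAt_const.mul h1).sub ((hTrat s hs).div_const 2)
  have htI : t ∈ Ioo 0 T := ⟨ht0, hT1⟩
  have hEm : AEStronglyMeasurable
      (fun s => (Complex.I * ((⟪x_c s, E s⟫_ℝ : ℝ) : ℂ) - (Q s).trace / 2))
      (volume.restrict (Ioo 0 T)) := by
    have h1 : (Ioo 0 T \ (S : Set ℝ)) =ᵐ[volume] Ioo 0 T :=
      sdiff_null_ae_eq_self (S.finite_toSet.measure_zero _)
    rw [← Measure.restrict_congr_set h1]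
    refine ContinuousOn.aestronglyMeasurable ?_ (measurableSet_Ioo.diff S.finite_toSet.measurableSet)
    intro s hs
    exact (hIoo s hs.1 (hS s ⟨hs.1.1.le, hs.1.2.le⟩ hs.2)).continuousWithinAt
  obtain ⟨C1, hC1⟩ := isCompact_Icc.exists_bound_of_continuousOn
    (hTr.mono (fun s (hs : s ∈ Icc 0 T) => (⟨hs.1, hs.2.trans_lt hT2⟩ : s ∈ Ico 0 Tplus)))
  obtain ⟨C2, hC2⟩ := isCompact_Icc.exists_bound_of_continuousOn
    (hx.continuousOn (s := Icc 0 T))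
  have hInt : IntegrableOn
      (fun s => (Complex.I * ((⟪x_c s, E s⟫_ℝ : ℝ) : ℂ) - (Q s).trace / 2)) (Ioo 0 T) := by
    refine IntegrableOn.of_bound (by simp) hEm (C2 * C + C1 / 2) ?_
    refine (ae_restrict_iff' measurableSet_Ioo).2 (Eventually.of_forall fun s hs => ?_)
    have hs' : s ∈ Icc 0 T := ⟨hs.1.le, hs.2.le⟩
    refine (norm_sub_le _ _).trans (add_le_add ?_ ?_)
    · rw [norm_mul, Complex.norm_I, one_mul, Complex.norm_real]
      refine (norm_inner_le_norm _ _).trans ?_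
      exact mul_le_mul (hC2 s hs') (hC s hs') (norm_nonneg _) ((norm_nonneg _).trans (hC2 s hs'))
    · rw [norm_div]
      have := hC1 s hs'
      simp only [Complex.norm_ofNat]
      linarith
  refine intervalIntegral.integral_hasDerivAt_right ?_ ⟨Ioo 0 T, Ioo_mem_nhds ht0 hT1, hEm⟩
    (hIoo t htI hEt)
  rw [intervalIntegrable_iff_integrableOn_Ioo_of_le ht0.le]
  exact hInt.mono_set (Ioo_subset_Ioo_right hT1.le)

theorem action_deriv {N : ℕ} (V : EucSp N → ℝ) (hV : Continuous V) 
    (x_c v : ℝ → EucSp N) (a : EucSp N) (t : ℝ) (x : EucSp N) (hv : Continuous v)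
    (hx : Continuous x_c) (hxt : HasDerivAt x_c (v t) t) (hvt : HasDerivAt v a t) :
    HasDerivAt (fun τ => action V x_c v τ x)
      (-(1/2) * ‖v t‖ ^ 2 - V (x_c t) + ⟪a, x - x_c t⟫_ℝ) t := by
  have hc : Continuous (fun s => ((1:ℝ)/2 * ‖v s‖ ^ 2 - V (x_c s))) := by fun_prop
  have h1 := intervalIntegral.integral_hasDerivAt_right (hc.intervalIntegrable 0 t)
    (hc.stronglyMeasurableAtFilter _ _) hc.continuousAt
  have h2 := h1.fun_add (hvt.inner ℝ (hxt.const_sub x))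
  unfold action
  refine h2.congr_deriv ?_
  rw [inner_neg_right, real_inner_self_eq_norm_sq]
  ring

theorem qForm_deriv {N : ℕ} (Q : ℝ → Matrix (Fin N) (Fin N) ℂ) (Q' : Matrix (Fin N) (Fin N) ℂ)
    (x_c : ℝ → EucSp N) (w : EucSp N) (t : ℝ) (x : EucSp N)
    (hQ : HasDerivAt Q Q' t) (hM : (Q t)ᵀ = Q t) (hx : HasDerivAt x_c w t) :
    HasDerivAt (fun τ => qFormC (Q τ) (x - x_c τ))
      (cvec (x - x_c t) ⬝ᵥ Q' *ᵥ cvec (x - x_c t)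
        - 2 * (cvec w ⬝ᵥ Q t *ᵥ cvec (x - x_c t))) t := by
  have hy : ∀ i, HasDerivAt (fun τ => (((x - x_c τ) i : ℝ) : ℂ)) (-(w i : ℂ)) t := by
    intro i
    have h := (EuclideanSpace.proj (𝕜 := ℝ) i).hasFDerivAt.comp_hasDerivAt t (hx.const_sub x)
    have h2 := h.ofReal_comp
    exact h2.congr_deriv (by
      change (((-w) i : ℝ) : ℂ) = _
      simp)
  have hq : ∀ i j, HasDerivAt (fun τ => Q τ i j) (Q' i j) t := fun i j => by
    have := entry_deriv (hQ.hasDerivWithinAt (s := univ)) i j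
    simpa using this
  have hs := HasDerivAt.fun_sum (u := Finset.univ) fun i _ => HasDerivAt.fun_sum (u := Finset.univ)
    fun j _ => ((hq i j).fun_mul (hy j)).fun_mul (hy i)
  unfold qFormC
  refine hs.congr_deriv ?_
  have : 2 * (cvec w ⬝ᵥ Q t *ᵥ cvec (x - x_c t)) = cvec w ⬝ᵥ Q t *ᵥ cvec (x - x_c t) +
     cvec (x - x_c t) ⬝ᵥ Q t *ᵥ cvec w := by
    rw [sym_dot _ hM (cvec (x - x_c t))]; ring
  rw [this]
  simp only [dotProduct, mulVec, cvec, Finset.mul_sum, ← Finset.sum_add_distrib,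
    ← Finset.sum_sub_distrib]
  exact Finset.sum_congr rfl fun i _ => Finset.sum_congr rfl fun j _ => by
    ring

/-- At every time `t ∈ (0, T⁺)` where `E` is continuous and every `x`,
the trajectory-coherent state satisfies
`i ∂ₜψ̃ + ½ Δψ̃ - V ψ̃ + ⟨E(t), x⟩ ψ̃ = r(t,x)`,
where `r` is the cubic Taylor remainder of `V` at `x_c(t)` multiplied by `-ψ̃`. -/
theorem statement8 {N : ℕ} (hN : 1 ≤ N) (V : EucSp N → ℝ) (hV : Subquadratic V)
    (E : ℝ → EucSp N) (hE : PiecewiseContinuous E) (b : ℝ) (hb : 0 < b)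
    (x₀ v₀ : EucSp N) (x_c v : ℝ → EucSp N) (hxc : IsNewtonSol V E x₀ v₀ x_c v)
    (Tplus : ℝ) (Q : ℝ → Matrix (Fin N) (Fin N) ℂ)
    (hQ0 : Q 0 = riccatiInit N b)
    (hQ : ∀ t ∈ Set.Ico 0 Tplus, HasDerivWithinAt Q (riccatiF V x_c Q t) (Set.Ici 0) t) :
    ∀ t : ℝ, 0 < t → t < Tplus → ContinuousAt E t → ∀ x : EucSp N,
      Complex.I * deriv (fun τ => psiTilde V E b x_c v Q τ x) t
        + (1/2 : ℂ) * ∑ i, iteratedFDeriv ℝ 2 (fun y => psiTilde V E b x_c v Q t y) x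
            ![EuclideanSpace.single i 1, EuclideanSpace.single i 1]
        - (V x : ℂ) * psiTilde V E b x_c v Q t x
        + ((⟪E t, x⟫_ℝ : ℝ) : ℂ) * psiTilde V E b x_c v Q t x
      = rRem V E b x_c v Q t x := by
  intro t ht0 ht hEt x
  obtain ⟨-, -, hvc, hxd, hvd⟩ := hxc
  have hxcont : Continuous x_c := continuous_iff_continuousAt.2 fun s => (hxd s).continuousAt
  have hM := Q_symm V hV b x_c Tplus Q hQ0 hQ t ht0 ht
  have hQt : HasDerivAt Q (riccatiF V x_c Q t) t :=
    (hQ t ⟨ht0.le, ht⟩).hasDerivAt (Ici_mem_nhds ht0)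
  have hQc : ContinuousOn Q (Ico 0 Tplus) := fun s hs =>
    (hQ s hs).continuousWithinAt.mono Ico_subset_Ici_self
  have h1 := (action_deriv V hV.1.continuous x_c v _ t x hvc hxcont (hxd t) (hvd t hEt)).ofReal_comp
  have h2 := qForm_deriv Q _ x_c _ t x hQt hM (hxd t)
  have h3 := E_int E hE x_c hxcont Tplus Q hQc t ht0 ht hEt
  have h4 := ((((h1.fun_add (h2.const_mul (1/2 : ℂ))).const_mul Complex.I).fun_add h3).cexp).const_mul
    ((b ^ ((N : ℝ) / 4) / CN N : ℝ) : ℂ)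
  have hP : ((b ^ ((N : ℝ) / 4) / CN N : ℝ) : ℂ) *
    Complex.exp (Complex.I * (((action V x_c v t x : ℝ) : ℂ)
        + (1/2 : ℂ) * qFormC (Q t) (x - x_c t))
      + ∫ s in (0:ℝ)..t, (Complex.I * ((⟪x_c s, E s⟫_ℝ : ℝ) : ℂ) - (Q s).trace / 2))
      = psiTilde V E b x_c v Q t x := rfl
  rw [← mul_assoc, hP] at h4
  have h5 : deriv (fun τ => psiTilde V E b x_c v Q τ x) t = _ := h4.deriv
  rw [h5]
  simp only [laplace V E b x_c v Q t x hM]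
  rw [← Finset.mul_sum, Finset.sum_add_distrib, Finset.sum_neg_distrib]
  have hsq : ∑ i, (cvec (v t) i + (Q t *ᵥ cvec (x - x_c t)) i) ^ 2
      = ((‖v t‖ ^ 2 : ℝ) : ℂ) + 2 * (cvec (v t) ⬝ᵥ Q t *ᵥ cvec (x - x_c t))
        + cvec (x - x_c t) ⬝ᵥ (Q t ^ 2) *ᵥ cvec (x - x_c t) := by
    have ha : cvec (x - x_c t) ⬝ᵥ (Q t ^ 2) *ᵥ cvec (x - x_c t)
        = (Q t *ᵥ cvec (x - x_c t)) ⬝ᵥ (Q t *ᵥ cvec (x - x_c t)) := by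
      rw [pow_two, ← mulVec_mulVec, sym_dot _ hM]
    have hb2 : ((‖v t‖ ^ 2 : ℝ) : ℂ) = cvec (v t) ⬝ᵥ cvec (v t) := by
      rw [EuclideanSpace.norm_sq_eq]
      simp [dotProduct, cvec, pow_two]
    rw [ha, hb2]
    simp only [dotProduct, Finset.mul_sum, ← Finset.sum_add_distrib]
    exact Finset.sum_congr rfl fun i _ => by ring
  have hric : cvec (x - x_c t) ⬝ᵥ riccatiF V x_c Q t *ᵥ cvec (x - x_c t)
      = -(cvec (x - x_c t) ⬝ᵥ (Q t ^ 2) *ᵥ cvec (x - x_c t))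
        - ((qFormR (hessMat V (x_c t)) (x - x_c t) : ℝ) : ℂ) := by
    have hq : ((qFormR (hessMat V (x_c t)) (x - x_c t) : ℝ) : ℂ)
      = qFormC ((hessMat V (x_c t)).map (fun a : ℝ => (a : ℂ))) (x - x_c t) := by
      simp [qFormR, qFormC]
    rw [hq, qFormC_eq, riccatiF, neg_mulVec, add_mulVec, dotProduct_neg, dotProduct_add]
    ring
  have htr : ∑ i, Complex.I * Q t i i = Complex.I * (Q t).trace := by
    rw [← Finset.mul_sum]; rfl
  have hEx : ⟪E t, x⟫_ℝ = ⟪E t, x - x_c t⟫_ℝ + ⟪x_c t, E t⟫_ℝ := by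
    rw [inner_sub_right, real_inner_comm (E t) (x_c t)]; ring
  rw [hsq, hric, rRem, taylorRem3, hEx, inner_sub_left]
  rw [htr]
  push_cast
  ring_nf
  rw [Complex.I_sq]
  ring
end

section
/- Define C_* := (1/(6 C_N)) (∫_{ℝ^N} ‖y‖⁶ e^{−‖y‖²} dy)^{1/2}. With x_c, Q, ψ̃ as in the definition of the trajectory-coherent state, Q₂(t) := Im Q(t) positive definite, and r(t,x) := −( V(x) − V(x_c(t)) − ⟨∇V(x_c(t)), x − x_c(t)⟩ − ½⟨V''(x_c(t))(x − x_c(t)), x − x_c(t)⟩ ) ψ̃(t,x), one has for every t ∈ [0, T⁺): ‖r(t,·)‖_{L²(ℝ^N)} ≤ C_* · ‖V^{(3)}‖∞ · ‖Q₂(t)^{−1}‖^{3/2}, where ‖V^{(3)}‖∞ := sup_x ‖V^{(3)}(x)‖ is the supremum of the norm of the third derivative of V and ‖Q₂(t)^{−1}‖ is the matrix operator norm. -/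
open MeasureTheory Matrix Real Set Filter
open scoped InnerProductSpace ENNReal Topology

noncomputable section

attribute [local instance] Matrix.normedAddCommGroup Matrix.normedSpace

end

attribute [local instance] Matrix.normedAddCommGroup Matrix.normedSpace


lemma hess_aux {N : ℕ} (V : EucSp N → ℝ) (x y : EucSp N) :
    iteratedFDeriv ℝ 2 V x (fun _ => y) = qFormR (hessMat V x) y := by
  have hy : y = ∑ i, y i • EuclideanSpace.single i (1 : ℝ) := by
    have := (EuclideanSpace.basisFun (Fin N) ℝ).sum_repr y
    simpa using this.symm
  rw [iteratedFDeriv_two_apply]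
  conv_lhs => rw [hy]
  simp only [map_sum, map_smul, qFormR, hessMat, Matrix.of_apply, iteratedFDeriv_two_apply,
    _root_.sum_apply, _root_.smul_apply, smul_eq_mul, Finset.mul_sum,
    Matrix.cons_val_zero, Matrix.cons_val_one]
  rw [Finset.sum_comm]
  refine Finset.sum_congr rfl fun i _ => Finset.sum_congr rfl fun j _ => ?_
  ring

lemma taylor_bound {N : ℕ} (V : EucSp N → ℝ) (hV : ContDiff ℝ (⊤ : ℕ∞) V)
    (M3 : ℝ) (hM3 : ∀ x, ‖iteratedFDeriv ℝ 3 V x‖ ≤ M3) (x_c : ℝ → EucSp N) (t : ℝ)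
    (x : EucSp N) :
    |taylorRem3 V x_c t x| ≤ M3 / 6 * ‖x - x_c t‖ ^ 3 := by
  set a := x_c t with ha
  set y := x - a with hy
  have h := map_add_eq_sum_add_integral_iteratedFDeriv (f := V) (x := a) (y := y) (n := 2)
    (fun t _ => ((contDiff_infty.1 hV 3).contDiffAt))
  have hay : a + y = x := by simp [hy]
  have hgrad : ⟪gradient V a, y⟫_ℝ = fderiv ℝ V a y := by
    rw [gradient, InnerProductSpace.toDual_symm_apply]
  have hrem : taylorRem3 V x_c t x = (1/2 : ℝ) *
      ∫ s in (0:ℝ)..1, (1 - s)^2 • iteratedFDeriv ℝ 3 V (a + s • y) (fun _ ↦ y) := by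
    unfold taylorRem3
    rw [← ha, ← hy, hgrad, ← hess_aux]
    rw [hay] at h
    rw [h]
    simp [Finset.sum_range_succ, iteratedFDeriv_one_apply]
    ring
  have hint : ‖∫ s in (0:ℝ)..1, (1 - s)^2 • iteratedFDeriv ℝ 3 V (a + s • y) (fun _ ↦ y)‖ ≤
      ∫ s in (0:ℝ)..1, (1 - s)^2 * (M3 * ‖y‖ ^ 3) := by
    apply intervalIntegral.norm_integral_le_of_norm_le zero_le_one
    · refine Filter.Eventually.of_forall fun s _ => ?_
      rw [norm_smul, Real.norm_of_nonneg (sq_nonneg _)]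
      gcongr
      refine (ContinuousMultilinearMap.le_opNorm _ _).trans ?_
      simp only [Finset.prod_const, Finset.card_univ, Fintype.card_fin]
      gcongr
      exact hM3 _
    · apply Continuous.intervalIntegrable
      fun_prop
  have hI : ∫ s in (0:ℝ)..1, (1 - s)^2 * (M3 * ‖y‖ ^ 3) = (1/3) * (M3 * ‖y‖ ^ 3) := by
    rw [intervalIntegral.integral_mul_const]
    congr 1
    rw [intervalIntegral.integral_comp_sub_left (fun s => s ^ 2)]
    norm_num
  rw [hrem, abs_mul, ← Real.norm_eq_abs (∫ s in (0:ℝ)..1, _), abs_of_pos (by norm_num)]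
  rw [hI] at hint
  linarith

lemma det_hasDerivAt {N : ℕ} {A : ℝ → Matrix (Fin N) (Fin N) ℝ} {A' : Matrix (Fin N) (Fin N) ℝ}
    {t : ℝ} (h : HasDerivAt A A' t) (hu : IsUnit (A t).det) :
    HasDerivAt (fun s => (A s).det) ((A t).det * ((A t)⁻¹ * A').trace) t := by
  have hd : Differentiable ℝ (fun M : Matrix (Fin N) (Fin N) ℝ => M.det) := by
    simp only [Matrix.det_apply']
    fun_prop
  have h1 : HasDerivAt (fun s => (A s).det) (fderiv ℝ (fun M : Matrix (Fin N) (Fin N) ℝ => M.det) (A t) A') t :=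
    (hd (A t)).hasFDerivAt.comp_hasDerivAt t h
  have hl : HasDerivAt (fun s : ℝ => A t + s • A') A' 0 := by
    have := ((hasDerivAt_id (0:ℝ)).smul_const A').const_add (A t)
    rw [one_smul] at this
    exact this
  have h2 : HasDerivAt (fun s : ℝ => (A t + s • A').det)
      (fderiv ℝ (fun M : Matrix (Fin N) (Fin N) ℝ => M.det) (A t) A') 0 := by
    have hf : HasFDerivAt (fun M : Matrix (Fin N) (Fin N) ℝ => M.det)
        (fderiv ℝ (fun M : Matrix (Fin N) (Fin N) ℝ => M.det) (A t)) (A t + (0:ℝ) • A') := by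
      rw [zero_smul, add_zero]
      exact (hd (A t)).hasFDerivAt
    exact hf.comp_hasDerivAt (0:ℝ) hl
  have h3 : (fun s : ℝ => (A t + s • A').det) = fun s => (A t).det *
      (1 + ((A t)⁻¹ * A').trace * s + (det (1 + (Polynomial.X : Polynomial ℝ) •
        ((A t)⁻¹ * A').map Polynomial.C)).divX.divX.eval s * s ^ 2) := by
    funext s
    rw [← Matrix.det_one_add_smul, ← Matrix.det_mul, mul_add, mul_one, Matrix.mul_smul,
      ← mul_assoc, Matrix.mul_nonsing_inv _ hu, one_mul]
  have h4 : HasDerivAt (fun s : ℝ => (A t + s • A').det) ((A t).det * ((A t)⁻¹ * A').trace) 0 := by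
    rw [h3]
    apply HasDerivAt.const_mul
    have e1 := ((hasDerivAt_id (0:ℝ)).const_mul ((A t)⁻¹ * A').trace).const_add 1
    have e2 := ((det (1 + (Polynomial.X : Polynomial ℝ) •
        ((A t)⁻¹ * A').map Polynomial.C)).divX.divX.hasDerivAt (0:ℝ)).mul ((hasDerivAt_id (0:ℝ)).pow 2)
    convert! e1.add e2 using 1
    simp
  rw [h2.unique h4] at h1
  exact h1

lemma imPart_deriv {N : ℕ} {Q : ℝ → Matrix (Fin N) (Fin N) ℂ} {Q' : Matrix (Fin N) (Fin N) ℂ}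
    {t : ℝ} (h : HasDerivAt Q Q' t) : HasDerivAt (fun s => ImPart (Q s)) (ImPart Q') t := by
  refine hasDerivAt_pi.2 fun i => hasDerivAt_pi.2 fun j => ?_
  have := hasDerivAt_pi.1 (hasDerivAt_pi.1 h i) j
  exact Complex.imCLM.hasFDerivAt.comp_hasDerivAt t this

lemma im_ricc {N : ℕ} (M : Matrix (Fin N) (Fin N) ℂ) (H : Matrix (Fin N) (Fin N) ℝ) :
    ImPart (-(M ^ 2 + H.map (fun a : ℝ => (a : ℂ)))) =
      -(RePart M * ImPart M + ImPart M * RePart M) := by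
  ext i j
  simp [ImPart, RePart, sq, Matrix.mul_apply, Finset.sum_add_distrib]

lemma det_formula {N : ℕ} (V : EucSp N → ℝ) (b : ℝ) (hb : 0 < b) (x_c : ℝ → EucSp N)
    (Tplus : ℝ) (Q : ℝ → Matrix (Fin N) (Fin N) ℂ)
    (hQ0 : Q 0 = riccatiInit N b)
    (hQ : ∀ t ∈ Set.Ico 0 Tplus, HasDerivWithinAt Q (riccatiF V x_c Q t) (Set.Ici 0) t)
    (hpos : ∀ t ∈ Set.Ico 0 Tplus, (ImPart (Q t)).PosDef) (t : ℝ) (ht : t ∈ Set.Ico 0 Tplus) :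
    ContinuousOn Q (Set.Icc 0 t) ∧
    √((ImPart (Q t)).det) = b ^ ((N : ℝ) / 2) * Real.exp (-∫ s in (0:ℝ)..t, (RePart (Q s)).trace) := by
  have hsub : ∀ s ∈ Set.Icc 0 t, s ∈ Set.Ico 0 Tplus := fun s hs => ⟨hs.1, hs.2.trans_lt ht.2⟩
  have hc : ContinuousOn Q (Set.Icc 0 t) := fun s hs =>
    (hQ s (hsub s hs)).continuousWithinAt.mono Set.Icc_subset_Ici_self
  refine ⟨hc, ?_⟩
  have hce : ∀ i j, ContinuousOn (fun s => Q s i j) (Set.Icc 0 t) := fun i j =>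
    (continuous_apply j).comp_continuousOn ((continuous_apply i).comp_continuousOn hc)
  have hcim : ContinuousOn (fun s => ImPart (Q s)) (Set.Icc 0 t) :=
    continuousOn_pi.2 fun i => continuousOn_pi.2 fun j =>
      Complex.continuous_im.comp_continuousOn (hce i j)
  have hctr : ContinuousOn (fun s => (RePart (Q s)).trace) (Set.Icc 0 t) := by
    simp only [Matrix.trace, Matrix.diag, RePart, Matrix.map_apply]
    exact continuousOn_finsetSum _ fun i _ => Complex.continuous_re.comp_continuousOn (hce i i)
  have hcdet : ContinuousOn (fun s => (ImPart (Q s)).det) (Set.Icc 0 t) :=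
    (Continuous.matrix_det continuous_id).comp_continuousOn hcim
  have hne : ∀ s ∈ Set.Icc 0 t, (ImPart (Q s)).det ≠ 0 := fun s hs => (hpos s (hsub s hs)).det_pos.ne'
  have key : ∫ s in (0:ℝ)..t, (-2 * (RePart (Q s)).trace) =
      Real.log (ImPart (Q t)).det - Real.log (ImPart (Q 0)).det := by
    refine intervalIntegral.integral_eq_sub_of_hasDerivAt_of_le ht.1 (f := fun s => Real.log (ImPart (Q s)).det)
      (hcdet.log hne) ?_ ?_
    · intro s hs
      have hs' : s ∈ Set.Icc 0 t := Set.Ioo_subset_Icc_self hs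
      have hd := (hQ s (hsub s hs')).hasDerivAt (Ici_mem_nhds hs.1)
      have hu : IsUnit (ImPart (Q s)).det := isUnit_iff_ne_zero.2 (hne s hs')
      have h1 := (det_hasDerivAt (imPart_deriv hd) hu).log (hne s hs')
      convert! h1 using 1
      rw [mul_div_cancel_left₀ _ (hne s hs'), riccatiF, im_ricc, mul_neg, Matrix.trace_neg, mul_add,
        Matrix.trace_add, ← mul_assoc, ← mul_assoc, Matrix.nonsing_inv_mul _ hu, one_mul,
        Matrix.trace_mul_comm, ← mul_assoc, Matrix.mul_nonsing_inv _ hu, one_mul]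
      ring
    · apply ContinuousOn.intervalIntegrable
      rw [Set.uIcc_of_le ht.1]
      exact hctr.const_mul _
  have h0 : (ImPart (Q 0)).det = b ^ N := by
    have : ImPart (Q 0) = b • (1 : Matrix (Fin N) (Fin N) ℝ) := by
      rw [hQ0]
      ext i j
      simp [ImPart, riccatiInit, Matrix.one_apply]
      split_ifs <;> simp
    rw [this, Matrix.det_smul]
    simp
  rw [intervalIntegral.integral_const_mul, h0] at key
  have hD := (hpos t ht).det_pos
  have hlog : Real.log (ImPart (Q t)).det = Real.log (b ^ N) + -2 * ∫ s in (0:ℝ)..t, (RePart (Q s)).trace := by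
    linarith
  rw [← Real.exp_log hD, hlog, Real.exp_add, Real.exp_log (by positivity),
    Real.sqrt_mul (by positivity)]
  congr 1
  · rw [Real.sqrt_eq_rpow, ← Real.rpow_natCast, ← Real.rpow_mul hb.le]
    ring_nf
  · rw [← Real.exp_half]
    congr 1
    ring

lemma E_integrable {N : ℕ} (E : ℝ → EucSp N) (hE : PiecewiseContinuous E) (x_c : ℝ → EucSp N)
    (hx : Continuous x_c) (t : ℝ) (ht : 0 ≤ t) :
    IntervalIntegrable (fun s => ⟪x_c s, E s⟫_ℝ) volume 0 t := by
  obtain ⟨S, hS, C, hC⟩ := hE 0 t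
  obtain ⟨D, hD⟩ := (isCompact_Icc (a := (0:ℝ)) (b := t)).exists_bound_of_continuousOn hx.continuousOn
  rw [intervalIntegrable_iff_integrableOn_Icc_of_le ht]
  have hcont : ContinuousOn (fun s => ⟪x_c s, E s⟫_ℝ) (Set.Icc 0 t \ S) := fun s hs =>
    (ContinuousAt.inner hx.continuousAt (hS s hs.1 hs.2)).continuousWithinAt
  have hm : MeasurableSet (Set.Icc 0 t \ (S : Set ℝ)) :=
    measurableSet_Icc.diff S.finite_toSet.measurableSet
  have hi : IntegrableOn (fun s => ⟪x_c s, E s⟫_ℝ) (Set.Icc 0 t \ S) := by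
    refine IntegrableOn.of_bound ?_ (hcont.aestronglyMeasurable hm) (D * C) ?_
    · exact (measure_mono Set.sdiff_subset).trans_lt measure_Icc_lt_top
    · refine (ae_restrict_iff' hm).2 (Filter.Eventually.of_forall fun s hs => ?_)
      refine (norm_inner_le_norm _ _).trans ?_
      have := hD s hs.1
      have := hC s hs.1
      gcongr
      exact (norm_nonneg _).trans (hD s hs.1)
  refine hi.congr_set_ae ?_
  refine (sdiff_null_ae_eq_self ?_).symm
  exact S.finite_toSet.measure_zero _

lemma psi_norm {N : ℕ} (V : EucSp N → ℝ)
    (E : ℝ → EucSp N) (hE : PiecewiseContinuous E) (b : ℝ) (hb : 0 < b)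
    (x_c v : ℝ → EucSp N) (hx : Continuous x_c)
    (Q : ℝ → Matrix (Fin N) (Fin N) ℂ) (t : ℝ) (ht : 0 ≤ t)
    (hc : ContinuousOn Q (Set.Icc 0 t))
    (hdet : √((ImPart (Q t)).det) = b ^ ((N : ℝ) / 2) * Real.exp (-∫ s in (0:ℝ)..t, (RePart (Q s)).trace))
    (x : EucSp N) :
    ‖psiTilde V E b x_c v Q t x‖ ^ 2 =
      √((ImPart (Q t)).det) / (CN N) ^ 2 * Real.exp (-qFormR (ImPart (Q t)) (x - x_c t)) := by
  have hce : ∀ i j, ContinuousOn (fun s => Q s i j) (Set.Icc 0 t) := fun i j =>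
    (continuous_apply j).comp_continuousOn ((continuous_apply i).comp_continuousOn hc)
  have hctr : ContinuousOn (fun s => (Q s).trace) (Set.Icc 0 t) := by
    simp only [Matrix.trace, Matrix.diag]
    exact continuousOn_finsetSum _ fun i _ => hce i i
  have hi1 : IntervalIntegrable (fun s => Complex.I * ((⟪x_c s, E s⟫_ℝ : ℝ) : ℂ)) volume 0 t :=
    IntervalIntegrable.const_mul
      ⟨(E_integrable E hE x_c hx t ht).1.ofReal, (E_integrable E hE x_c hx t ht).2.ofReal⟩ _
  have hi2 : IntervalIntegrable (fun s => (Q s).trace / 2) volume 0 t := by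
    apply ContinuousOn.intervalIntegrable
    rw [Set.uIcc_of_le ht]
    exact hctr.div_const _
  have hre : (∫ s in (0:ℝ)..t, (Complex.I * ((⟪x_c s, E s⟫_ℝ : ℝ) : ℂ) - (Q s).trace / 2)).re =
      -(∫ s in (0:ℝ)..t, (RePart (Q s)).trace) / 2 := by
    have h := Complex.reCLM.intervalIntegral_comp_comm (hi1.sub hi2)
    simp only [Complex.reCLM_apply] at h
    rw [← h, neg_div, ← intervalIntegral.integral_div, ← intervalIntegral.integral_neg]
    congr 1
    funext s
    have : ((Q s).trace / 2).re = (RePart (Q s)).trace / 2 := by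
      simp [Matrix.trace, RePart]
    simp [this]
  have him : (qFormC (Q t) (x - x_c t)).im = qFormR (ImPart (Q t)) (x - x_c t) := by
    simp [qFormC, qFormR, ImPart]
  have hre2 : (Complex.I * (((action V x_c v t x : ℝ) : ℂ)
        + (1/2 : ℂ) * qFormC (Q t) (x - x_c t))).re = - qFormR (ImPart (Q t)) (x - x_c t) / 2 := by
    rw [← him]
    simp
    ring
  unfold psiTilde
  rw [norm_mul, Complex.norm_exp, Complex.add_re, hre, hre2, hdet, Complex.norm_real, mul_pow,
    Real.norm_eq_abs, sq_abs, div_pow, ← Real.exp_nat_mul]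
  have e1 : (b ^ ((N:ℝ)/4)) ^ 2 = b ^ ((N:ℝ)/2) := by
    rw [← Real.rpow_natCast, ← Real.rpow_mul hb.le]; congr 1; push_cast; ring
  rw [e1]
  have e2 : ∀ p q : ℝ, Real.exp (((2:ℕ):ℝ) * (-p/2 + -q/2)) = Real.exp (-q) * Real.exp (-p) := by
    intro p q; rw [← Real.exp_add]; congr 1; push_cast; ring
  rw [e2]
  ring

lemma posdef_aux {N : ℕ} (P : Matrix (Fin N) (Fin N) ℝ) (hP : P.PosDef) :
    ∃ B : EucSp N →ₗ[ℝ] EucSp N, |LinearMap.det B| = √(P.det) ∧ LinearMap.det B ≠ 0 ∧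
      (∀ y, qFormR P y = ‖B y‖ ^ 2) ∧ ∀ y, ‖y‖ ^ 2 ≤ opNorm P⁻¹ * ‖B y‖ ^ 2 := by
  obtain ⟨B, hB⟩ : ∃ B : Matrix (Fin N) (Fin N) ℝ, P = Bᵀ * B := by
    open scoped MatrixOrder in
    have := (CStarAlgebra.nonneg_iff_eq_star_mul_self (a := P)).1 hP.posSemidef.nonneg
    simpa [Matrix.star_eq_conjTranspose] using this
  have hdet : P.det = B.det ^ 2 := by rw [hB, Matrix.det_mul, Matrix.det_transpose, sq]
  have hdp := hP.det_pos
  have hB0 : B.det ≠ 0 := by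
    intro h; rw [hdet, h] at hdp; simp at hdp
  have hBu : IsUnit B.det := isUnit_iff_ne_zero.2 hB0
  have hBtu : IsUnit Bᵀ.det := by rwa [Matrix.det_transpose]
  have hLdet : LinearMap.det (Matrix.toEuclideanLin B) = B.det := by
    rw [Matrix.toEuclideanLin_eq_toLin_orthonormal, LinearMap.det_toLin]
  have hinner : ∀ (M : Matrix (Fin N) (Fin N) ℝ) (y z : EucSp N),
      ⟪Matrix.toEuclideanLin M y, z⟫_ℝ = ⟪y, Matrix.toEuclideanLin Mᵀ z⟫_ℝ := by
    intro M y z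
    have := Matrix.toEuclideanLin_conjTranspose_eq_adjoint M
    simp only [conjTranspose_eq_transpose_of_trivial] at this
    rw [this, LinearMap.adjoint_inner_right]
  have hmul : ∀ (M K : Matrix (Fin N) (Fin N) ℝ) (y : EucSp N),
      Matrix.toEuclideanLin M (Matrix.toEuclideanLin K y) = Matrix.toEuclideanLin (M * K) y := by
    intro M K y
    simp [Matrix.toLpLin_apply]
  have hone : ∀ y : EucSp N, Matrix.toEuclideanLin (1 : Matrix (Fin N) (Fin N) ℝ) y = y := by
    intro y
    simp [Matrix.toLpLin_apply]
  refine ⟨Matrix.toEuclideanLin B, ?_, ?_, ?_, ?_⟩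
  · rw [hLdet, hdet, Real.sqrt_sq_eq_abs]
  · rwa [hLdet]
  · intro y
    rw [← real_inner_self_eq_norm_sq, hinner, hmul, ← hB]
    simp only [qFormR, PiLp.inner_apply, Matrix.toLpLin_apply, Matrix.mulVec, dotProduct]
    simp [Finset.sum_mul]
  · intro y
    set w := Matrix.toEuclideanLin (Bᵀ)⁻¹ y with hw
    have e1 : ‖y‖ ^ 2 = ⟪Matrix.toEuclideanLin B y, w⟫_ℝ := by
      rw [hinner, hw, hmul, Matrix.mul_nonsing_inv _ hBtu, hone, real_inner_self_eq_norm_sq]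
    have e2 : ‖w‖ ^ 2 = ⟪y, Matrix.toEuclideanLin P⁻¹ y⟫_ℝ := by
      rw [← real_inner_self_eq_norm_sq]
      conv_lhs => rw [hw]
      rw [hinner, hmul, Matrix.transpose_nonsing_inv, Matrix.transpose_transpose, hB,
        Matrix.mul_inv_rev]
    have e3 : ‖w‖ ^ 2 ≤ opNorm P⁻¹ * ‖y‖ ^ 2 := by
      rw [e2]
      refine (real_inner_le_norm _ _).trans ?_
      have : ‖Matrix.toEuclideanLin P⁻¹ y‖ ≤ opNorm P⁻¹ * ‖y‖ :=
        (LinearMap.toContinuousLinearMap (Matrix.toEuclideanLin P⁻¹)).le_opNorm y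
      nlinarith [norm_nonneg y]
    have e4 : ‖y‖ ^ 2 ≤ ‖Matrix.toEuclideanLin B y‖ * ‖w‖ := by
      rw [e1]; exact real_inner_le_norm _ _
    by_cases hy : ‖y‖ ^ 2 = 0
    · rw [hy]
      exact mul_nonneg (norm_nonneg _) (sq_nonneg _)
    have hpos : 0 < ‖y‖ ^ 2 := lt_of_le_of_ne (sq_nonneg _) (Ne.symm hy)
    have e5 : (‖y‖ ^ 2) ^ 2 ≤ ‖Matrix.toEuclideanLin B y‖ ^ 2 * ‖w‖ ^ 2 := by
      rw [← mul_pow]; gcongr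
    have e6 : ‖y‖ ^ 2 * ‖y‖ ^ 2 ≤ (opNorm P⁻¹ * ‖Matrix.toEuclideanLin B y‖ ^ 2) * ‖y‖ ^ 2 := by
      nlinarith [sq_nonneg ‖Matrix.toEuclideanLin B y‖]
    exact le_of_mul_le_mul_right e6 hpos

lemma gauss_int {N : ℕ} :
    Integrable (fun y : EucSp N => ‖y‖ ^ 6 * Real.exp (-‖y‖ ^ 2)) := by
  have h0 : Integrable (fun y : EucSp N => Real.exp (-(1/2) * ‖y‖ ^ 2)) := by
    have := GaussianFourier.integrable_cexp_neg_mul_sq_norm_add (V := EucSp N) (b := 1/2) (by norm_num) 0 0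
    convert this.norm using 2 with y
    rw [Complex.norm_exp]
    congr 1
    simp [← Complex.ofReal_pow]
  refine (h0.const_mul 48).mono' (by fun_prop) (Filter.Eventually.of_forall fun y => ?_)
  rw [Real.norm_of_nonneg (by positivity)]
  set u := ‖y‖ ^ 2 with hu
  have hu0 : 0 ≤ u := sq_nonneg _
  have h1 : (u/2)^3 / 6 ≤ Real.exp (u/2) := by
    have := Real.pow_div_factorial_le_exp (u/2) (by positivity) 3
    simpa [Nat.factorial] using this
  have h2 : Real.exp (-(1/2) * u) = Real.exp (u/2) * Real.exp (-u) := by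
    rw [← Real.exp_add]; congr 1; ring
  have h3 : ‖y‖ ^ 6 = u ^ 3 := by rw [hu]; ring
  rw [h2, h3, ← mul_assoc]
  gcongr
  linarith

lemma final_aux {N : ℕ} (V : EucSp N → ℝ) (hV : ContDiff ℝ (⊤ : ℕ∞) V)
    (M3 : ℝ) (hM3 : ∀ x, ‖iteratedFDeriv ℝ 3 V x‖ ≤ M3)
    (E : ℝ → EucSp N) (b : ℝ) (x_c v : ℝ → EucSp N)
    (Q : ℝ → Matrix (Fin N) (Fin N) ℂ) (t : ℝ) (hP : (ImPart (Q t)).PosDef)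
    (hpsi : ∀ x, ‖psiTilde V E b x_c v Q t x‖ ^ 2 =
      √((ImPart (Q t)).det) / (CN N) ^ 2 * Real.exp (-qFormR (ImPart (Q t)) (x - x_c t))) :
    eLpNorm (rRem V E b x_c v Q t) 2 (volume : Measure (EucSp N)) ≤
        ENNReal.ofReal (Cstar N * M3 * opNorm ((ImPart (Q t))⁻¹) ^ ((3:ℝ)/2)) := by
  set P := ImPart (Q t) with hPdef
  obtain ⟨B, hBdet, hB0, hBq, hBn⟩ := posdef_aux P hP
  have hM0 : 0 ≤ M3 := (norm_nonneg _).trans (hM3 0)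
  have hop : 0 ≤ opNorm P⁻¹ := norm_nonneg _
  have hC0 : 0 ≤ CN N := Real.sqrt_nonneg _
  set g : EucSp N → ℝ := fun z => ‖z‖ ^ 6 * Real.exp (-‖z‖ ^ 2) with hg
  have hg0 : ∀ z, 0 ≤ g z := fun z => by positivity
  have hgm : Measurable fun z => ENNReal.ofReal (g z) := by
    have : Continuous g := by fun_prop
    exact this.measurable.ennreal_ofReal
  set K : ℝ := (M3 / 6) ^ 2 / (CN N) ^ 2 * opNorm P⁻¹ ^ 3 with hK
  have hK0 : 0 ≤ K := by positivity
  have hpt : ∀ x, ‖rRem V E b x_c v Q t x‖ₑ ^ 2 ≤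
      ENNReal.ofReal (K * |LinearMap.det B|) * ENNReal.ofReal (g (B (x - x_c t))) := by
    intro x
    rw [← ENNReal.ofReal_mul (by positivity), ← ofReal_norm, ← ENNReal.ofReal_pow (norm_nonneg _)]
    apply ENNReal.ofReal_le_ofReal
    rw [rRem, norm_mul, mul_pow, hpsi, norm_neg, Complex.norm_real, Real.norm_eq_abs, hBq, ← hBdet]
    have h1 := taylor_bound V hV M3 hM3 x_c t x
    set y := x - x_c t
    have h2 : ‖y‖ ^ 6 ≤ opNorm P⁻¹ ^ 3 * ‖B y‖ ^ 6 := by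
      calc ‖y‖ ^ 6 = (‖y‖ ^ 2) ^ 3 := by ring
        _ ≤ (opNorm P⁻¹ * ‖B y‖ ^ 2) ^ 3 := by gcongr; exact hBn y
        _ = _ := by ring
    calc |taylorRem3 V x_c t x| ^ 2 * (|LinearMap.det B| / CN N ^ 2 * Real.exp (-‖B y‖ ^ 2))
        ≤ (M3 / 6 * ‖y‖ ^ 3) ^ 2 * (|LinearMap.det B| / CN N ^ 2 * Real.exp (-‖B y‖ ^ 2)) := by
          gcongr
      _ = (M3 / 6) ^ 2 * ‖y‖ ^ 6 * (|LinearMap.det B| / CN N ^ 2 * Real.exp (-‖B y‖ ^ 2)) := by ring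
      _ ≤ (M3 / 6) ^ 2 * (opNorm P⁻¹ ^ 3 * ‖B y‖ ^ 6) *
          (|LinearMap.det B| / CN N ^ 2 * Real.exp (-‖B y‖ ^ 2)) := by gcongr
      _ = _ := by rw [hK, hg]; ring
  have hBm : Measurable B := B.continuous_of_finiteDimensional.measurable
  have hlin : ∫⁻ x, ‖rRem V E b x_c v Q t x‖ₑ ^ 2 ≤ ENNReal.ofReal (K * ∫ z, g z) := by
    calc ∫⁻ x, ‖rRem V E b x_c v Q t x‖ₑ ^ 2
        ≤ ∫⁻ x, ENNReal.ofReal (K * |LinearMap.det B|) * ENNReal.ofReal (g (B (x - x_c t))) :=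
          lintegral_mono hpt
      _ = ENNReal.ofReal (K * |LinearMap.det B|) * ∫⁻ x, ENNReal.ofReal (g (B (x - x_c t))) := by
          rw [lintegral_const_mul]
          exact hgm.comp (hBm.comp (measurable_id.sub_const _))
      _ = ENNReal.ofReal (K * |LinearMap.det B|) * ∫⁻ x, ENNReal.ofReal (g (B x)) := by
          rw [lintegral_sub_right_eq_self (fun x => ENNReal.ofReal (g (B x)))]
      _ = ENNReal.ofReal (K * |LinearMap.det B|) *
            (ENNReal.ofReal |(LinearMap.det B)⁻¹| * ∫⁻ z, ENNReal.ofReal (g z)) := by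
          rw [← lintegral_map hgm hBm, Measure.map_linearMap_addHaar_eq_smul_addHaar _ hB0,
            lintegral_smul_measure, smul_eq_mul]
      _ = ENNReal.ofReal (K * ∫ z, g z) := by
          rw [← ofReal_integral_eq_lintegral_ofReal gauss_int (Filter.Eventually.of_forall hg0),
            ← mul_assoc, ← ENNReal.ofReal_mul (by positivity), ← ENNReal.ofReal_mul (by positivity),
            abs_inv, mul_assoc K, mul_inv_cancel₀ (abs_ne_zero.2 hB0), mul_one]
  have hI0 : 0 ≤ ∫ z, g z := integral_nonneg hg0
  have hR0 : 0 ≤ Cstar N * M3 * opNorm P⁻¹ ^ ((3:ℝ)/2) := by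
    unfold Cstar; positivity
  have hsq : K * ∫ z, g z = (Cstar N * M3 * opNorm P⁻¹ ^ ((3:ℝ)/2)) ^ 2 := by
    have e1 : (opNorm P⁻¹ ^ ((3:ℝ)/2)) ^ 2 = opNorm P⁻¹ ^ 3 := by
      rw [← Real.rpow_natCast, ← Real.rpow_mul hop, ← Real.rpow_natCast]; norm_num
    rw [mul_pow, e1, mul_pow, Cstar, mul_pow, Real.sq_sqrt hI0, hK]
    ring
  rw [eLpNorm_eq_lintegral_rpow_enorm_toReal (by norm_num) (by norm_num)]
  simp only [ENNReal.toReal_ofNat, ENNReal.rpow_ofNat]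
  rw [hsq, ENNReal.ofReal_pow hR0] at hlin
  calc _ ≤ (ENNReal.ofReal (Cstar N * M3 * opNorm P⁻¹ ^ ((3:ℝ)/2)) ^ 2) ^ (1 / (2:ℝ)) := by
        gcongr
    _ = _ := by
        rw [← ENNReal.rpow_natCast, ← ENNReal.rpow_mul]; norm_num

/-- `L²` bound on the source term:
`‖r(t,·)‖_{L²} ≤ C_* ‖V⁽³⁾‖∞ ‖Q₂(t)⁻¹‖^{3/2}`. -/
theorem statement10 {N : ℕ} (hN : 1 ≤ N) (V : EucSp N → ℝ) (hV : Subquadratic V)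
    (M3 : ℝ) (hM3 : ∀ x, ‖iteratedFDeriv ℝ 3 V x‖ ≤ M3)
    (E : ℝ → EucSp N) (hE : PiecewiseContinuous E) (b : ℝ) (hb : 0 < b)
    (x₀ v₀ : EucSp N) (x_c v : ℝ → EucSp N) (hxc : IsNewtonSol V E x₀ v₀ x_c v)
    (Tplus : ℝ) (Q : ℝ → Matrix (Fin N) (Fin N) ℂ)
    (hQ0 : Q 0 = riccatiInit N b)
    (hQ : ∀ t ∈ Set.Ico 0 Tplus, HasDerivWithinAt Q (riccatiF V x_c Q t) (Set.Ici 0) t)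
    (hpos : ∀ t ∈ Set.Ico 0 Tplus, (ImPart (Q t)).PosDef) :
    ∀ t ∈ Set.Ico 0 Tplus,
      eLpNorm (rRem V E b x_c v Q t) 2 (volume : Measure (EucSp N)) ≤
        ENNReal.ofReal (Cstar N * M3 * opNorm ((ImPart (Q t))⁻¹) ^ ((3:ℝ)/2)) := by
  intro t ht
  have hx : Continuous x_c := continuous_iff_continuousAt.2 fun s => (hxc.2.2.2.1 s).continuousAt
  obtain ⟨hc, hdet⟩ := det_formula V b hb x_c Tplus Q hQ0 hQ hpos t ht
  exact final_aux V hV.1 M3 hM3 E b x_c v Q t (hpos t ht)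
    (psi_norm V E hE b hb x_c v hx Q t ht.1 hc hdet)
end
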